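/- Let r_n denote the maximal number of alternating associative monomials in the expansion of a commutator monomial on n variables. Then r_1 = 1, r_2 = 2, r_3 = 4, r_4 = 6, r_5 = 8, and for every natural number k: r_{6+4k} = 14·6^k, r_{7+4k} = 24·6^k, r_{8+4k} = 36·6^k, and r_{9+4k} = 56·6^k. -/

import Mathlib

open scoped Classical

/-- Full plane binary trees with leaves labeled by natural numbers
(representing the variables `X_i`). -/
inductive BTree : Type where
  | leaf : ℕ → BTree
  | node : BTree → BTree → BTree

namespace BTree

/-- The list of leaf labels, from left to right. -/
def leaves : BTree → List ℕ
  | leaf a => [a]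
  | node l r => l.leaves ++ r.leaves

/-- The expansion set `W(T, ℓ)` of the commutator monomial modeled by `T`. -/
def words : BTree → Finset (List ℕ)
  | leaf a => {[a]}
  | node l r =>
      ((l.words ×ˢ r.words).image fun p => p.1 ++ p.2) ∪
      ((l.words ×ˢ r.words).image fun p => p.2 ++ p.1)

end BTree

/-- A word (list of labels) is alternating: consecutive entries differ, and no entry
lies strictly between its two neighbours. -/
def IsAlternating (w : List ℕ) : Prop :=
  (∀ i, i + 1 < w.length → w.getD i 0 ≠ w.getD (i + 1) 0) ∧
  (∀ i, i + 2 < w.length →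
    ¬ (w.getD i 0 < w.getD (i + 1) 0 ∧ w.getD (i + 1) 0 < w.getD (i + 2) 0) ∧
    ¬ (w.getD (i + 2) 0 < w.getD (i + 1) 0 ∧ w.getD (i + 1) 0 < w.getD i 0))

/-- A word is forward alternating: alternating, and it does not start with an ascent. -/
def IsForwardAlternating (w : List ℕ) : Prop :=
  IsAlternating w ∧ (w.length ≤ 1 ∨ w.getD 1 0 < w.getD 0 0)

/-- Number of alternating words in the expansion of `t`. -/
noncomputable def altCount (t : BTree) : ℕ :=
  (t.words.filter fun w => IsAlternating w).card

/-- Number of forward alternating words in the expansion of `t`. -/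
noncomputable def faltCount (t : BTree) : ℕ :=
  (t.words.filter fun w => IsForwardAlternating w).card

/-- `rAlt n` : the maximal number of alternating associative monomials in a commutator
monomial whose leaves are labeled bijectively by `{1, …, n}`. -/
noncomputable def rAlt (n : ℕ) : ℕ :=
  sSup {m | ∃ t : BTree, t.leaves.Perm (List.range' 1 n) ∧ m = altCount t}

/-- `rFAlt n` : the forward-alternating analogue of `rAlt n`. -/
noncomputable def rFAlt (n : ℕ) : ℕ :=
  sSup {m | ∃ t : BTree, t.leaves.Perm (List.range' 1 n) ∧ m = faltCount t}

/-- The number of alternating permutations of `{1, …, n}` (denoted `Ẽ_n`). -/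
noncomputable def altPerms (n : ℕ) : ℕ :=
  Nat.card {σ : Equiv.Perm (Fin n) // IsAlternating (List.ofFn fun i => (σ i : ℕ))}

/-- The number of forward alternating permutations of `{1, …, n}` (denoted `E_n`). -/
noncomputable def faltPerms (n : ℕ) : ℕ :=
  Nat.card {σ : Equiv.Perm (Fin n) // IsForwardAlternating (List.ofFn fun i => (σ i : ℕ))}

namespace BTree

/-- Whether a tree has an even number of leaves. -/
def ev : BTree → Bool
  | leaf _ => false
  | node l r => !(xor l.ev r.ev)

theorem length_leaves_pos (t : BTree) : 0 < t.leaves.length := by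
  induction t with
  | leaf a => simp [leaves]
  | node l r hl hr => simp [leaves]; omega

theorem ev_eq (t : BTree) : t.ev = decide (Even t.leaves.length) := by
  induction t with
  | leaf a => simp [ev, leaves]
  | node l r hl hr =>
    simp only [ev, leaves, hl, hr, List.length_append, Nat.even_add]
    by_cases h1 : Even l.leaves.length <;> by_cases h2 : Even r.leaves.length <;> simp [h1, h2]

theorem length_of_mem_words {t : BTree} :
    ∀ {w : List ℕ}, w ∈ t.words → w.length = t.leaves.length := by
  induction t with
  | leaf a => intro w hw; simp [words] at hw; simp [hw, leaves]
  | node l r hl hr =>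
    intro w hw
    simp only [words, Finset.mem_union, Finset.mem_image, Finset.mem_product] at hw
    rcases hw with ⟨p, ⟨h1, h2⟩, rfl⟩ | ⟨p, ⟨h1, h2⟩, rfl⟩ <;>
      simp [leaves, hl h1, hr h2, add_comm]

end BTree

/-- Alternating words whose first entry is a peak (`b = true`) or a valley (`b = false`). -/
def Zig : Bool → List ℕ → Prop
  | _, [] => True
  | _, [_] => True
  | b, x :: y :: l => (if b then y < x else x < y) ∧ Zig (!b) (y :: l)

/-- The comparison between a letter `x` and its right neighbour `y`, where `x` is a peak if
`b = true` and a valley otherwise. -/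
def Step (b : Bool) (x y : ℕ) : Prop := if b then y < x else x < y

instance (b : Bool) (x y : ℕ) : Decidable (Step b x y) := by
  unfold Step; infer_instance

theorem step_not {b : Bool} {x y : ℕ} : Step (!b) x y ↔ Step b y x := by
  cases b <;> simp [Step]

theorem zig_cons_cons {b : Bool} {x y : ℕ} {l : List ℕ} :
    Zig b (x :: y :: l) ↔ Step b x y ∧ Zig (!b) (y :: l) := by
  simp [Zig, Step]

theorem isAlternating_cons_cons {x y : ℕ} {l : List ℕ} :
    IsAlternating (x :: y :: l) ↔ x ≠ y ∧ IsAlternating (y :: l) ∧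
      ∀ z ∈ l.head?, ¬ (x < y ∧ y < z) ∧ ¬ (z < y ∧ y < x) := by
  unfold IsAlternating
  constructor
  · rintro ⟨h1, h2⟩
    refine ⟨by simpa using h1 0 (by simp), ⟨fun i hi => ?_, fun i hi => ?_⟩, fun z hz => ?_⟩
    · simpa using h1 (i + 1) (by simpa using hi)
    · simpa using h2 (i + 1) (by simpa using hi)
    · cases l with
      | nil => simp at hz
      | cons a l => simp at hz; subst hz; simpa using h2 0 (by simp)
  · rintro ⟨h0, ⟨h1, h2⟩, h3⟩
    refine ⟨fun i hi => ?_, fun i hi => ?_⟩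
    · cases i with
      | zero => simpa using h0
      | succ i => simpa using h1 i (by simpa using hi)
    · cases i with
      | zero =>
        cases l with
        | nil => simp at hi
        | cons a l => simpa using h3 a (by simp)
      | succ i => simpa using h2 i (by simpa using hi)

theorem isAlternating_iff {w : List ℕ} : IsAlternating w ↔ Zig true w ∨ Zig false w := by
  induction w with
  | nil => simp [IsAlternating, Zig]
  | cons x w ih =>
    cases w with
    | nil => simp [IsAlternating, Zig]
    | cons y l =>
      rw [isAlternating_cons_cons, ih, zig_cons_cons, zig_cons_cons]
      cases l with
      | nil => simp [Zig, Step]; omega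
      | cons z l =>
        simp only [zig_cons_cons, Step]
        simp
        by_cases h1 : Zig true (z :: l) <;> by_cases h2 : Zig false (z :: l) <;>
          simp [h1, h2] <;> omega

/-- The type of the last letter of an alternating word of length `n` and type `b`. -/
def lastType (b : Bool) (n : ℕ) : Bool := if Even n then !b else b

theorem zig_append {b : Bool} {u v : List ℕ} (hu : u ≠ []) (hv : v ≠ []) :
    Zig b (u ++ v) ↔ Zig b u ∧ Zig (!lastType b u.length) v ∧
      Step (lastType b u.length) (u.getLastD 0) (v.headD 0) := by
  induction u generalizing b with
  | nil => exact absurd rfl hu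
  | cons x u ih =>
    cases u with
    | nil =>
      cases v with
      | nil => exact absurd rfl hv
      | cons y v => simp [zig_cons_cons, lastType, Zig]; tauto
    | cons y u =>
      have h : lastType b (x :: y :: u).length = lastType (!b) (y :: u).length := by
        simp only [lastType, List.length_cons, Nat.even_add_one]
        by_cases he : Even u.length <;> simp [he]
      have := ih (b := !b) (by simp)
      rw [h]
      simp only [List.cons_append, zig_cons_cons] at this ⊢
      rw [this]
      simp only [List.getLastD_cons]
      tauto

namespace BTree

/-- The type of the last letter of an alternating word of type `b` in the expansion of `t`. -/
def endType (t : BTree) (b : Bool) : Bool := if t.ev then !b else b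

theorem endType_eq (t : BTree) (b : Bool) : t.endType b = lastType b t.leaves.length := by
  simp [endType, lastType, ev_eq]

@[simp] theorem endType_endType (t : BTree) (b : Bool) : t.endType (t.endType b) = b := by
  unfold endType; split <;> simp

theorem endType_not (t : BTree) (b : Bool) : t.endType (!b) = !t.endType b := by
  unfold endType; split <;> simp

theorem endType_node (l r : BTree) (b : Bool) :
    (node l r).endType b = r.endType (!l.endType b) := by
  simp only [endType, ev]
  by_cases h1 : l.ev = true <;> by_cases h2 : r.ev = true <;> simp [h1, h2]

/-- The pairs (first letter, last letter) of the words obtained by joining words with ends in `X`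
to words with ends in `Y`, such that the junction is an admissible step of type `b`. -/
def joinEnds (b : Bool) (X Y : Multiset (ℕ × ℕ)) : Multiset (ℕ × ℕ) :=
  X.bind fun u => Y.bind fun v => if Step b u.2 v.1 then {(u.1, v.2)} else 0

/-- The pairs (first letter, last letter) of the alternating words of type `b` in the expansion
of a tree, with multiplicity. -/
def ends : BTree → Bool → Multiset (ℕ × ℕ)
  | leaf a, _ => {(a, a)}
  | node l r, b =>
      joinEnds (l.endType b) (l.ends b) (r.ends (!l.endType b)) +
      joinEnds (r.endType b) (r.ends b) (l.ends (!r.endType b))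

end BTree

open BTree in
theorem map_swap_joinEnds (b : Bool) (X Y : Multiset (ℕ × ℕ)) :
    (joinEnds b X Y).map Prod.swap = joinEnds (!b) (Y.map Prod.swap) (X.map Prod.swap) := by
  simp only [joinEnds, Multiset.map_bind, Multiset.bind_map]
  rw [Multiset.bind_bind]
  refine Multiset.bind_congr fun v _ => Multiset.bind_congr fun u _ => ?_
  simp only [step_not, Prod.fst_swap, Prod.snd_swap]
  split <;> simp

namespace BTree

theorem map_swap_ends (t : BTree) (b : Bool) : (t.ends b).map Prod.swap = t.ends (t.endType b) := by
  induction t generalizing b with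
  | leaf a => simp [ends]
  | node l r hl hr =>
    have h2 : (node l r).endType b = l.endType (!r.endType b) := by
      rw [endType_node, endType_not, endType_not]; simp only [endType]
      by_cases h1 : l.ev = true <;> by_cases h2 : r.ev = true <;> simp [h1, h2]
    simp only [ends, Multiset.map_add, map_swap_joinEnds, hl, hr]
    rw [add_comm]
    congr 2
    · rw [h2]; simp
    · rw [h2]
    · rw [h2]; simp
    · rw [endType_node]; simp
    · rw [endType_node]
    · rw [endType_node]; simp

theorem sum_words_le (t : BTree) (b : Bool) (φ : ℕ → ℕ → ℕ) :
    ∑ w ∈ t.words with Zig b w, φ (w.headD 0) (w.getLastD 0) ≤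
      ((t.ends b).map fun e => φ e.1 e.2).sum := by
  induction t generalizing b φ with
  | leaf a => simp [words, ends, Finset.filter_singleton, Zig]
  | node l r hl hr =>
    have key : ∀ l r : BTree,
        (∀ (b : Bool) (φ : ℕ → ℕ → ℕ), ∑ w ∈ l.words with Zig b w, φ (w.headD 0) (w.getLastD 0) ≤
          ((l.ends b).map fun e => φ e.1 e.2).sum) →
        (∀ (b : Bool) (φ : ℕ → ℕ → ℕ), ∑ w ∈ r.words with Zig b w, φ (w.headD 0) (w.getLastD 0) ≤
          ((r.ends b).map fun e => φ e.1 e.2).sum) →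
        ∑ p ∈ l.words ×ˢ r.words, (if Zig b (p.1 ++ p.2) then
          φ ((p.1 ++ p.2).headD 0) ((p.1 ++ p.2).getLastD 0) else 0) ≤
        ((joinEnds (l.endType b) (l.ends b) (r.ends (!l.endType b))).map
          fun e => φ e.1 e.2).sum := by
      intro l r hl hr
      simp only [joinEnds, Multiset.map_bind, Multiset.sum_bind]
      rw [Finset.sum_product]
      refine le_trans ?_ (hl b fun x y =>
        ((r.ends (!l.endType b)).map fun v => if Step (l.endType b) y v.1 then φ x v.2 else 0).sum)
        |>.trans (le_of_eq ?_)
      · rw [Finset.sum_filter]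
        refine Finset.sum_le_sum fun u hu => ?_
        have hu0 : u ≠ [] := by
          rintro rfl
          have := length_of_mem_words hu
          have := length_leaves_pos l
          simp at *; omega
        split_ifs with hz
        · refine le_trans ?_ (hr _ fun x y =>
            if Step (l.endType b) (u.getLastD 0) x then φ (u.headD 0) y else 0)
          rw [Finset.sum_filter]
          refine Finset.sum_le_sum fun v hv => ?_
          have hv0 : v ≠ [] := by
            rintro rfl
            have := length_of_mem_words hv
            have := length_leaves_pos r
            simp at *; omega
          simp only [zig_append hu0 hv0, hz, length_of_mem_words hu, ← endType_eq]
          have h1 : (u ++ v).headD 0 = u.headD 0 := by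
            cases u with
            | nil => exact absurd rfl hu0
            | cons => rfl
          have h2 : (u ++ v).getLastD 0 = v.getLastD 0 := by
            rw [List.getLastD_eq_getLast?, List.getLast?_append_of_ne_nil _ hv0,
              List.getLastD_eq_getLast?]
          rw [h1, h2]
          split_ifs <;> simp_all
        · refine le_of_eq (Finset.sum_eq_zero fun v hv => ?_)
          have hv0 : v ≠ [] := by
            rintro rfl
            have := length_of_mem_words hv
            have := length_leaves_pos r
            simp at *; omega
          rw [if_neg]
          rw [zig_append hu0 hv0]
          tauto
      · congr 1
        refine Multiset.map_congr rfl fun u _ => ?_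
        congr 1
        refine Multiset.map_congr rfl fun v _ => ?_
        split_ifs <;> simp
    have h1 := key l r hl hr
    have h2 := key r l hr hl
    simp only [words, ends, Multiset.map_add, Multiset.sum_add]
    refine le_trans ?_ (add_le_add h1 h2)
    rw [Finset.sum_filter]
    refine le_trans (le_of_le_of_eq (Nat.le_add_right _ _) Finset.sum_union_inter) ?_
    refine add_le_add (Finset.sum_image_le_of_nonneg fun _ _ => Nat.zero_le _) ?_
    refine (Finset.sum_image_le_of_nonneg fun _ _ => Nat.zero_le _).trans (le_of_eq ?_)
    rw [Finset.sum_product_right, Finset.sum_product]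

end BTree

/-- Threshold condition on a letter of type `b`; `none` imposes no condition. -/
def Meets (p : Option ℕ) (b : Bool) (x : ℕ) : Prop := ∀ s ∈ p, if b then s ≤ x else x < s

@[simp] theorem meets_none {b : Bool} {x : ℕ} : Meets none b x := by simp [Meets]

/-- The number of pairs in `X × Y` which form an admissible step of type `b`. -/
noncomputable def joinCount (b : Bool) (X Y : Multiset ℕ) : ℕ :=
  (X.map fun x => (Y.map fun y => if Step b x y then 1 else 0).sum).sum

theorem joinCount_not (b : Bool) (X Y : Multiset ℕ) : joinCount (!b) X Y = joinCount b Y X := by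
  simp only [joinCount, step_not]
  rw [Multiset.sum_map_sum_map]

theorem joinCount_le (b : Bool) (X Y : Multiset ℕ) :
    joinCount b X Y ≤ X.card * Y.card := by
  unfold joinCount
  refine (Multiset.sum_le_card_nsmul _ Y.card ?_).trans (by simp)
  simp only [Multiset.mem_map]
  rintro _ ⟨x, -, rfl⟩
  refine (Multiset.sum_le_card_nsmul _ 1 ?_).trans (by simp)
  simp only [Multiset.mem_map]
  rintro _ ⟨y, -, rfl⟩
  split <;> simp

namespace BTree

/-- The number of (ends of) words of type `b` whose first letter meets `p` and whose last letter
meets `q`. -/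
noncomputable def count (t : BTree) (b : Bool) (p q : Option ℕ) : ℕ :=
  ((t.ends b).map fun e => if Meets p b e.1 ∧ Meets q (t.endType b) e.2 then 1 else 0).sum

/-- The first letters of the words of type `b` whose last letter meets `p`. -/
noncomputable def firsts (t : BTree) (b : Bool) (p : Option ℕ) : Multiset ℕ :=
  (t.ends b).bind fun e => if Meets p (t.endType b) e.2 then {e.1} else 0

theorem count_endType (t : BTree) (b : Bool) (p q : Option ℕ) :
    t.count (t.endType b) p q = t.count b q p := by
  unfold count
  rw [← map_swap_ends, Multiset.map_map]
  simp [and_comm]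

theorem card_firsts (t : BTree) (b : Bool) (p : Option ℕ) :
    (t.firsts b p).card = t.count b none p := by
  simp only [firsts, count, Multiset.card_bind]
  congr 1
  refine Multiset.map_congr rfl fun e _ => ?_
  simp only [Function.comp, meets_none, true_and]
  split <;> simp

theorem countP_firsts (t : BTree) (b : Bool) (s : ℕ) (p : Option ℕ) :
    (t.firsts b p).countP (fun x => if b then s ≤ x else x < s) = t.count b (some s) p := by
  simp only [firsts, count, Multiset.countP_eq_card_filter, Multiset.filter_bind,
    Multiset.card_bind]
  congr 1
  refine Multiset.map_congr rfl fun e _ => ?_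
  have h : Meets (some s) b e.1 ↔ if b then s ≤ e.1 else e.1 < s := by simp [Meets]
  simp only [Function.comp, h]
  by_cases h1 : Meets p (t.endType b) e.2 <;>
    by_cases h2 : (if b then s ≤ e.1 else e.1 < s) <;> simp [h1, h2, Multiset.filter_singleton]

theorem count_le_count_none_left (t : BTree) (b : Bool) (p q : Option ℕ) :
    t.count b p q ≤ t.count b none q := by
  unfold count
  refine Multiset.sum_map_le_sum_map _ _ fun e _ => ?_
  by_cases h1 : Meets p b e.1 <;> simp [h1]

theorem count_le_count_none_right (t : BTree) (b : Bool) (p q : Option ℕ) :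
    t.count b p q ≤ t.count b p none := by
  rw [← count_endType, ← count_endType (p := none)]
  exact count_le_count_none_left _ _ _ _

theorem sum_joinEnds (b : Bool) (X Y : Multiset (ℕ × ℕ)) (P Q : ℕ → Prop) :
    ((joinEnds b X Y).map fun e => if P e.1 ∧ Q e.2 then 1 else 0).sum =
    joinCount b ((X.map Prod.swap).bind fun e => if P e.2 then {e.1} else 0)
      (Y.bind fun e => if Q e.2 then {e.1} else 0) := by
  simp only [joinEnds, joinCount, Multiset.map_bind, Multiset.sum_bind, Multiset.bind_map]
  congr 1
  refine Multiset.map_congr rfl fun u _ => ?_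
  by_cases hP : P u.1
  · simp only [hP, Prod.snd_swap, Prod.fst_swap, if_true, Multiset.map_singleton,
      Multiset.sum_singleton]
    congr 1
    refine Multiset.map_congr rfl fun v _ => ?_
    by_cases hQ : Q v.2 <;> by_cases hS : Step b u.2 v.1 <;> simp [hP, hQ, hS]
  · simp only [hP, Prod.snd_swap, if_false, Multiset.map_zero, Multiset.sum_zero]
    refine Multiset.sum_eq_zero fun x hx => ?_
    obtain ⟨v, -, rfl⟩ := Multiset.mem_map.1 hx
    by_cases hS : Step b u.2 v.1 <;> simp [hP, hS]

theorem count_node (l r : BTree) (b : Bool) (p q : Option ℕ) :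
    (node l r).count b p q =
      joinCount (l.endType b) (l.firsts (l.endType b) p) (r.firsts (!l.endType b) q) +
      joinCount (r.endType b) (r.firsts (r.endType b) p) (l.firsts (!r.endType b) q) := by
  have h2 : (node l r).endType b = l.endType (!r.endType b) := by
    rw [endType_node, endType_not, endType_not]; simp only [endType]
    by_cases h1 : l.ev = true <;> by_cases h2 : r.ev = true <;> simp [h1, h2]
  unfold count firsts
  simp only [ends, Multiset.map_add, Multiset.sum_add, sum_joinEnds, map_swap_ends,
    endType_endType]
  rw [endType_node, ← endType_node l r b, h2, ← h2, endType_node, ← endType_node l r b]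
theorem count_node_comm (l r : BTree) (b : Bool) (p q : Option ℕ) :
    (node l r).count b p q = (node r l).count b p q := by
  rw [count_node, count_node, add_comm]

/-- The number of (ends of) words of both types. -/
noncomputable def total (t : BTree) (p q : Option ℕ) : ℕ := t.count true p q + t.count false p q

theorem total_comm (t : BTree) (p q : Option ℕ) : t.total p q = t.total q p := by
  unfold total
  rw [← count_endType t true, ← count_endType t false]
  unfold endType
  by_cases h : t.ev = true <;> simp [h, add_comm]

end BTree

/-- The number of admissible junctions between two families of words, given by the letters at the
junction; peaks are `U₁`, `V₁` and valleys are `U₀`, `V₀`. -/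
noncomputable def crossCount (U₁ U₀ V₁ V₀ : Multiset ℕ) : ℕ :=
  joinCount true U₁ V₀ + joinCount true V₁ U₀

theorem crossCount_comm (U₁ U₀ V₁ V₀ : Multiset ℕ) :
    crossCount U₁ U₀ V₁ V₀ = crossCount V₁ V₀ U₁ U₀ := by
  simp [crossCount, add_comm]

namespace BTree

/-- `crossCount` for the first letters of two trees. -/
noncomputable def cross (l r : BTree) (p q : Option ℕ) : ℕ :=
  crossCount (l.firsts true p) (l.firsts false p) (r.firsts true q) (r.firsts false q)

theorem cross_comm (l r : BTree) (p q : Option ℕ) : cross l r p q = cross r l q p :=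
  crossCount_comm _ _ _ _

theorem total_node (l r : BTree) (p q : Option ℕ) :
    (node l r).total p q = cross l r p q + cross r l p q := by
  have h := fun X Y => joinCount_not true X Y
  simp only [Bool.not_true] at h
  simp only [total, count_node, cross, crossCount, endType]
  by_cases h1 : l.ev = true <;> by_cases h2 : r.ev = true <;> simp [h1, h2, h] <;> omega

theorem count_node_of_ev {l r : BTree} (hn : (node l r).ev = true) (b : Bool) :
    (node l r).count b none none = cross l r none none := by
  have h := fun X Y => joinCount_not true X Y
  simp only [Bool.not_true] at h
  simp only [ev] at hn
  simp only [count_node, cross, crossCount, endType]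
  by_cases h1 : l.ev = true <;> by_cases h2 : r.ev = true <;> cases b <;>
    simp [h1, h2, h] at hn ⊢ <;>
    omega

theorem count_node_le {l r : BTree} (hl : l.ev = true) (hr : r.ev = false) (b : Bool) :
    (node l r).count b none none ≤ 2 * l.count (!b) none none * r.count b none none := by
  simp only [count_node, endType, hl, hr, if_true, Bool.false_eq_true, if_false, Bool.not_not]
  have h1 := joinCount_not (!b) (r.firsts b none) (l.firsts (!b) none)
  simp only [Bool.not_not] at h1
  have h2 := joinCount_le (!b) (l.firsts (!b) none) (r.firsts b none)
  rw [card_firsts, card_firsts] at h2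
  rw [h1]
  linarith

end BTree

theorem le_add_sum_range_ite (n a m : ℕ) (h : n ≤ a + m) :
    n ≤ a + ∑ j ∈ Finset.range m, if a + 1 + j ≤ n then 1 else 0 := by
  induction m generalizing n with
  | zero => simpa using h
  | succ m ih =>
    rw [Finset.sum_range_succ]
    rcases Nat.lt_or_ge (a + m) n with h' | h'
    · have := ih (a + m) le_rfl
      have h2 : ∑ j ∈ Finset.range m, (if a + 1 + j ≤ a + m then 1 else 0) ≤
          ∑ j ∈ Finset.range m, (if a + 1 + j ≤ n then 1 else 0) :=
        Finset.sum_le_sum fun j _ => by split_ifs <;> omega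
      rw [if_pos (by omega)]
      omega
    · have := ih n h'
      omega

theorem sum_map_le_card_mul_add (X : Multiset ℕ) (f : ℕ → ℕ) (a m : ℕ) (h : ∀ u, f u ≤ a + m) :
    (X.map f).sum ≤ X.card * a + ∑ j ∈ Finset.range m, X.countP (fun u => a + 1 + j ≤ f u) := by
  induction X using Multiset.induction_on with
  | empty => simp
  | cons u X ih =>
    have := le_add_sum_range_ite (f u) a m (h u)
    simp only [Multiset.map_cons, Multiset.sum_cons, Multiset.card_cons, Multiset.countP_cons,
      Finset.sum_add_distrib, add_mul]
    omega

theorem sum_map_ite_eq_countP (X : Multiset ℕ) (p : ℕ → Prop) [DecidablePred p] :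
    (X.map fun x => if p x then 1 else 0).sum = X.countP p := by
  induction X using Multiset.induction_on with
  | empty => simp
  | cons x X ih => simp [ih, Multiset.countP_cons, add_comm]

theorem countP_le_countP_of_imp {X : Multiset ℕ} {p q : ℕ → Prop} [DecidablePred p]
    [DecidablePred q] (h : ∀ x, p x → q x) : X.countP p ≤ X.countP q := by
  simp only [Multiset.countP_eq_card_filter]
  exact Multiset.card_le_card (Multiset.monotone_filter_right X h)

theorem joinCount_true_eq_left (X Y : Multiset ℕ) :
    joinCount true X Y = (X.map fun x => Y.countP (· < x)).sum := by
  simp [joinCount, Step, sum_map_ite_eq_countP]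

theorem joinCount_true_eq_right (X Y : Multiset ℕ) :
    joinCount true X Y = (Y.map fun y => X.countP (y < ·)).sum := by
  unfold joinCount
  rw [Multiset.sum_map_sum_map]
  simp [Step, sum_map_ite_eq_countP]

theorem crossCount_le {U₁ U₀ V₁ V₀ : Multiset ℕ} {k h : ℕ}
    (hk : ∀ s, U₁.countP (s ≤ ·) + U₀.countP (· < s) ≤ k)
    (hh : ∀ s, V₁.countP (s ≤ ·) + V₀.countP (· < s) ≤ h)
    (h1 : V₁.card ≤ h) (h0 : V₀.card ≤ h) (hs : h ≤ V₁.card + V₀.card) :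
    crossCount U₁ U₀ V₁ V₀ ≤ U₁.card * (h - V₁.card) + U₀.card * (h - V₀.card) +
      (V₁.card + V₀.card - h) * k := by
  set m := V₁.card + V₀.card - h with hm
  set f : ℕ → ℕ := fun u => V₀.countP (· < u) with hf
  set g : ℕ → ℕ := fun u => V₁.countP (u < ·) with hg
  have hfm : ∀ u, f u ≤ (h - V₁.card) + m := fun u =>
    (Multiset.countP_le_card (p := (· < u)) (s := V₀)).trans (by omega)
  have hgm : ∀ u, g u ≤ (h - V₀.card) + m := fun u =>
    (Multiset.countP_le_card (p := (u < ·)) (s := V₁)).trans (by omega)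
  have e1 := sum_map_le_card_mul_add U₁ f _ m hfm
  have e0 := sum_map_le_card_mul_add U₀ g _ m hgm
  rw [← Finset.sum_range_reflect] at e0
  change (U₁.map fun u => V₀.countP (· < u)).sum ≤ _ at e1
  change (U₀.map fun u => V₁.countP (u < ·)).sum ≤ _ at e0
  unfold crossCount
  rw [joinCount_true_eq_left, joinCount_true_eq_right V₁]
  suffices hsum : ∑ j ∈ Finset.range m, U₁.countP (fun u => h - V₁.card + 1 + j ≤ f u) +
      ∑ j ∈ Finset.range m, U₀.countP (fun u => h - V₀.card + 1 + (m - 1 - j) ≤ g u) ≤ m * k by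
    omega
  rw [← Finset.sum_add_distrib]
  refine (Finset.sum_le_card_nsmul _ _ k fun j hj => ?_).trans (by simp)
  rw [Finset.mem_range] at hj
  have hno : ∀ u v, h - V₁.card + 1 + j ≤ f u → h - V₀.card + 1 + (m - 1 - j) ≤ g v → v < u := by
    intro u v hu hv
    by_contra! huv
    have h3 : f u ≤ f v := countP_le_countP_of_imp fun x hx => lt_of_lt_of_le hx huv
    have h4 : g v ≤ V₁.countP (v ≤ ·) := countP_le_countP_of_imp fun x hx => le_of_lt hx
    have h5 := hh v
    change _ + f v ≤ h at h5
    omega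
  by_cases hex : ∃ u, h - V₁.card + 1 + j ≤ f u
  · classical
    refine le_trans (add_le_add ?_ ?_) (hk (Nat.find hex))
    · exact countP_le_countP_of_imp fun u hu => Nat.find_min' hex hu
    · exact countP_le_countP_of_imp fun v hv => hno _ v (Nat.find_spec hex) hv
  · push Not at hex
    rw [Multiset.countP_eq_zero.2 (fun u _ => not_le.2 (hex u)), zero_add]
    refine le_trans ?_ (hk (U₀.sum + 1))
    refine le_trans (Multiset.countP_le_card _ _) ?_
    rw [(Multiset.countP_eq_card (s := U₀) (p := (· < U₀.sum + 1))).2 fun a ha =>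
      Nat.lt_succ_of_le (Multiset.single_le_sum (fun _ _ => Nat.zero_le _) a ha)]
    omega

/-- Bounds for a pair of multisets: total size, maximal size, maximal split count. -/
structure Level where
  S : ℤ
  M : ℤ
  K : ℤ

namespace Level

/-- The bilinear bound for `crossCount` in terms of levels. -/
def pr (x y : Level) : ℤ :=
  x.S * y.K + y.S * x.K - x.K * y.K - (x.M * (y.S - y.M) + (x.S - x.M) * y.M)

/-- Consistency of a level. -/
def Wf (x : Level) : Prop := x.M ≤ x.K ∧ x.K ≤ x.S ∧ x.S ≤ 2 * x.M

instance (x : Level) : Decidable x.Wf := by unfold Wf; infer_instance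

theorem pr_comm (x y : Level) : pr x y = pr y x := by unfold pr; ring

/-- Every nonnegative linear functional at `x` is dominated by its value at some element
of `V`. -/
def Dom (V : List Level) (x : Level) : Prop :=
  ∀ a b c : ℤ, 0 ≤ a → 0 ≤ b → 0 ≤ c →
    ∃ v ∈ V, a * x.S + b * x.M + c * x.K ≤ a * v.S + b * v.M + c * v.K

theorem Dom.exists_pr_le {V : List Level} {x y : Level} (hx : Dom V x) (hy : y.Wf) :
    ∃ v ∈ V, pr x y ≤ pr v y := by
  obtain ⟨h1, h2, h3⟩ := hy
  obtain ⟨v, hv, h⟩ := hx (y.K - y.M) (2 * y.M - y.S) (y.S - y.K) (by omega) (by omega) (by omega)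
  refine ⟨v, hv, ?_⟩
  unfold pr
  linarith

end Level

/-- `V` dominates the level of the pair of multisets `X₁`, `X₀`. -/
def Bounded (V : List Level) (X₁ X₀ : Multiset ℕ) : Prop :=
  ∀ s, Level.Dom V ⟨X₁.card + X₀.card, max X₁.card X₀.card,
    X₁.countP (s ≤ ·) + X₀.countP (· < s)⟩

theorem exists_isMax_split (X₁ X₀ : Multiset ℕ) :
    ∃ s, ∀ t, X₁.countP (t ≤ ·) + X₀.countP (· < t) ≤ X₁.countP (s ≤ ·) + X₀.countP (· < s) := by
  have hfin : (Set.range fun t => X₁.countP (t ≤ ·) + X₀.countP (· < t)).Finite :=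
    (Set.finite_Iic (X₁.card + X₀.card)).subset (by
      rintro _ ⟨t, rfl⟩
      exact add_le_add (Multiset.countP_le_card _ _) (Multiset.countP_le_card _ _))
  obtain ⟨_, ⟨s, rfl⟩, hs⟩ := Set.exists_max_image _ id hfin ⟨_, 0, rfl⟩
  exact ⟨s, fun t => hs _ ⟨t, rfl⟩⟩

theorem wf_of_isMax {X₁ X₀ : Multiset ℕ} {s : ℕ}
    (hs : ∀ t, X₁.countP (t ≤ ·) + X₀.countP (· < t) ≤ X₁.countP (s ≤ ·) + X₀.countP (· < s)) :
    (⟨X₁.card + X₀.card, max X₁.card X₀.card,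
    X₁.countP (s ≤ ·) + X₀.countP (· < s)⟩ : Level).Wf := by
  have h1 := hs 0
  have h2 := hs (X₀.sum + 1)
  rw [(Multiset.countP_eq_card (s := X₀) (p := (· < X₀.sum + 1))).2 fun a ha =>
      Nat.lt_succ_of_le (Multiset.single_le_sum (fun _ _ => Nat.zero_le _) a ha)] at h2
  rw [(Multiset.countP_eq_card (s := X₁) (p := (0 ≤ ·))).2 fun a ha => Nat.zero_le _] at h1
  have h3 := Multiset.countP_le_card (s ≤ ·) X₁
  have h4 := Multiset.countP_le_card (· < s) X₀
  refine ⟨?_, ?_, ?_⟩ <;> simp only <;> omega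

theorem crossCount_le_pr {U₁ U₀ V₁ V₀ : Multiset ℕ} {V W : List Level} (hU : Bounded V U₁ U₀)
    (hV : Bounded W V₁ V₀) (hwf : ∀ v ∈ V, v.Wf) :
    ∃ v ∈ V, ∃ w ∈ W, (crossCount U₁ U₀ V₁ V₀ : ℤ) ≤ Level.pr v w := by
  obtain ⟨s, hs⟩ := exists_isMax_split U₁ U₀
  obtain ⟨t, ht⟩ := exists_isMax_split V₁ V₀
  have wV := wf_of_isMax ht
  obtain ⟨v, hv, h1⟩ := (hU s).exists_pr_le wV
  obtain ⟨w, hw, h2⟩ := (hV t).exists_pr_le (hwf v hv)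
  refine ⟨v, hv, w, hw, ?_⟩
  rw [Level.pr_comm w v] at h2
  rw [Level.pr_comm _ v] at h2
  refine le_trans ?_ (h1.trans h2)
  obtain ⟨w1, w2, -⟩ := wV
  simp only at w1 w2
  have h0 := crossCount_le hs ht (by omega) (by omega) (by omega)
  unfold Level.pr
  simp only
  generalize hh : V₁.countP (t ≤ ·) = h at *
  generalize hh' : V₀.countP (· < t) = h' at *
  generalize U₁.countP (s ≤ ·) = k at *
  generalize U₀.countP (· < s) = k' at *
  zify [show V₁.card ≤ h + h' by omega, show V₀.card ≤ h + h' by omega,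
    show h + h' ≤ V₁.card + V₀.card by omega] at h0
  refine h0.trans ?_
  rcases le_total (U₁.card : ℤ) U₀.card with a | a <;>
    rcases le_total (V₁.card : ℤ) V₀.card with b | b <;>
    simp only [max_eq_left, max_eq_right, a, b] <;>
    nlinarith [mul_nonneg (sub_nonneg.2 a) (sub_nonneg.2 b)]

/-- Numerical bounds for the counts of a tree, see `BTree.Fits`. -/
structure Profile where
  T : ℤ
  M : ℤ
  H : ℤ
  K : ℤ
  J : ℤ

/-- Multiply a level by a natural number. -/
def Level.scale (p : ℕ) (v : Level) : Level := ⟨p * v.S, p * v.M, p * v.K⟩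

theorem Level.pr_scale (p q : ℕ) (v w : Level) :
    Level.pr (v.scale p) (w.scale q) = (p * q : ℕ) * Level.pr v w := by
  simp only [Level.pr, Level.scale]
  push_cast
  ring

theorem Level.Wf.scale {v : Level} (h : v.Wf) (p : ℕ) : (v.scale p).Wf := by
  obtain ⟨h1, h2, h3⟩ := h
  have hp : (0 : ℤ) ≤ p := Int.natCast_nonneg p
  simp only [Level.Wf, Level.scale]
  exact ⟨mul_le_mul_of_nonneg_left h1 hp, mul_le_mul_of_nonneg_left h2 hp, by nlinarith⟩

namespace Profile

/-- The level of the first letters of all words. -/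
def level₀ (x : Profile) : Level := ⟨x.T, x.M, x.H⟩

/-- Levels dominating that of the first letters of the words with a condition at the end. -/
def levels₁ (x : Profile) : List Level :=
  [⟨x.H, x.M, min x.K (x.J - x.M)⟩, ⟨x.H, min x.M (x.J - x.K), x.K⟩]

/-- All levels of the profile are consistent. -/
def Wf (x : Profile) : Prop := x.level₀.Wf ∧ ∀ v ∈ x.levels₁, v.Wf

instance (x : Profile) : Decidable x.Wf := by unfold Wf; infer_instance

end Profile

namespace BTree

/-- The counts of `t` are bounded by `p` times the profile `x`. -/
structure Fits (t : BTree) (p : ℕ) (x : Profile) : Prop where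
  tot : (t.total none none : ℤ) ≤ p * x.T
  cnt : ∀ b, (t.count b none none : ℤ) ≤ p * x.M
  half : ∀ s, (t.total (some s) none : ℤ) ≤ p * x.H
  full : ∀ s s', (t.total (some s) (some s') : ℤ) ≤ p * x.K
  mix : ∀ b s s', (t.count b (some s) none : ℤ) + t.total (some s) (some s') ≤ p * x.J

theorem countP_firsts_add (t : BTree) (s : ℕ) (p : Option ℕ) :
    (t.firsts true p).countP (s ≤ ·) + (t.firsts false p).countP (· < s) = t.total (some s) p := by
  rw [total, ← countP_firsts, ← countP_firsts]
  simp

theorem Fits.bounded_none {t : BTree} {p : ℕ} {x : Profile} (h : t.Fits p x) :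
    Bounded [x.level₀.scale p] (t.firsts true none) (t.firsts false none) := by
  intro s a b c ha hb hc
  refine ⟨_, List.mem_singleton_self _, ?_⟩
  simp only [Profile.level₀, Level.scale, card_firsts]
  have h1 := h.tot
  have h2 := countP_firsts_add t s none
  have h3 := h.half s
  have h4 : max (t.count true none none : ℤ) (t.count false none none) ≤ p * x.M :=
    max_le (h.cnt _) (h.cnt _)
  rw [← h2] at h3
  rw [total] at h1
  push_cast at h1 h3
  gcongr

theorem Fits.bounded_some {t : BTree} {p : ℕ} {x : Profile} (h : t.Fits p x) (s : ℕ) :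
    Bounded (x.levels₁.map (Level.scale p)) (t.firsts true (some s)) (t.firsts false (some s)) := by
  intro s' a b c ha hb hc
  have h1 := h.half s
  rw [total_comm] at h1
  have h3 := h.full s' s
  have h4 : max (t.count true none (some s) : ℤ) (t.count false none (some s)) ≤ p * x.M :=
    max_le (le_trans (by exact_mod_cast count_le_count_none_right _ _ _ _) (h.cnt true))
      (le_trans (by exact_mod_cast count_le_count_none_right _ _ _ _) (h.cnt false))
  have h5 : max (t.count true none (some s) : ℤ) (t.count false none (some s)) +
      t.total (some s') (some s) ≤ p * x.J := by
    have e1 := h.mix (t.endType true) s s'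
    have e2 := h.mix (t.endType false) s s'
    rw [count_endType, total_comm] at e1 e2
    rcases max_choice (t.count true none (some s) : ℤ) (t.count false none (some s)) with h | h <;>
      rw [h] <;> assumption
  rw [total] at h1
  push_cast at h1
  simp only [card_firsts]
  rw [← Nat.cast_add (Multiset.countP _ _), countP_firsts_add]
  generalize max (t.count true none (some s) : ℤ) (t.count false none (some s)) = m at *
  generalize (t.total (some s') (some s) : ℤ) = k at *
  have h6 : a * ((t.count true none (some s) : ℤ) + t.count false none (some s)) ≤ a * (p * x.H) :=
    mul_le_mul_of_nonneg_left h1 ha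
  have hp : (0 : ℤ) ≤ p := Int.natCast_nonneg p
  rcases le_total c b with hbc | hbc
  · refine ⟨_, List.mem_map_of_mem (List.mem_cons_self ..), ?_⟩
    simp only [Level.scale]
    rcases min_choice x.K (x.J - x.M) with hm | hm <;> rw [hm] <;> nlinarith
  · refine ⟨_, List.mem_map_of_mem (List.mem_cons_of_mem _ (List.mem_cons_self ..)), ?_⟩
    simp only [Level.scale]
    rcases min_choice x.M (x.J - x.K) with hm | hm <;> rw [hm] <;> nlinarith

theorem fits_leaf (z : ℕ) : (leaf z).Fits 1 ⟨2, 1, 1, 1, 2⟩ := by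
  refine ⟨?_, ?_, ?_, ?_, ?_⟩
  · simp [total, count, ends]
  · simp [count, ends]
  · intro s
    simp only [total, count, ends, Meets, endType, ev]
    by_cases h1 : s ≤ z <;> simp [h1, not_lt.2, not_le.1]
  · intro s s'
    simp only [total, count, ends, Meets, endType, ev]
    by_cases h1 : s ≤ z <;> by_cases h2 : s' ≤ z <;> simp [h1, h2, not_lt.2, not_le.1]
  · intro b s s'
    simp only [total, count, ends, Meets, endType, ev]
    by_cases h1 : s ≤ z <;> by_cases h2 : s' ≤ z <;> cases b <;> simp [h1, h2, not_lt.2, not_le.1]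

theorem Fits.comm {l r : BTree} {p : ℕ} {x : Profile} (h : (node l r).Fits p x) :
    (node r l).Fits p x := by
  have e : ∀ b p q, (node r l).count b p q = (node l r).count b p q :=
    fun b p q => count_node_comm _ _ _ _ _
  have e' : ∀ p q, (node r l).total p q = (node l r).total p q := by simp [total, e]
  exact ⟨by simpa [e'] using h.tot, by simpa [e] using h.cnt, by simpa [e'] using h.half,
    by simpa [e'] using h.full, by simpa [e, e'] using h.mix⟩

section node

variable {l r : BTree} {p q : ℕ} {x y z : Profile}

theorem Fits.cross_none (hl : l.Fits p x) (hr : r.Fits q y) (wx : x.Wf) :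
    (cross l r none none : ℤ) ≤ (p * q : ℕ) * Level.pr x.level₀ y.level₀ := by
  obtain ⟨v, hv, w, hw, h⟩ := crossCount_le_pr hl.bounded_none hr.bounded_none
    (by simpa using wx.1.scale p)
  rw [List.mem_singleton] at hv hw
  rw [hv, hw, Level.pr_scale] at h
  exact h

theorem Fits.cross_left (hl : l.Fits p x) (hr : r.Fits q y) (wx : x.Wf) (s : ℕ) :
    ∃ v ∈ x.levels₁, (cross l r (some s) none : ℤ) ≤ (p * q : ℕ) * Level.pr v y.level₀ := by
  obtain ⟨v, hv, w, hw, h⟩ := crossCount_le_pr (hl.bounded_some s) hr.bounded_none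
    (by simpa using fun v hv => (wx.2 v hv).scale p)
  rw [List.mem_map] at hv
  rw [List.mem_singleton] at hw
  obtain ⟨v, hv, rfl⟩ := hv
  rw [hw, Level.pr_scale] at h
  exact ⟨v, hv, h⟩

theorem Fits.cross_some (hl : l.Fits p x) (hr : r.Fits q y) (wx : x.Wf) (s s' : ℕ) :
    ∃ v ∈ x.levels₁, ∃ w ∈ y.levels₁,
      (cross l r (some s) (some s') : ℤ) ≤ (p * q : ℕ) * Level.pr v w := by
  obtain ⟨v, hv, w, hw, h⟩ := crossCount_le_pr (hl.bounded_some s) (hr.bounded_some s')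
    (by simpa using fun v hv => (wx.2 v hv).scale p)
  rw [List.mem_map] at hv hw
  obtain ⟨v, hv, rfl⟩ := hv
  obtain ⟨w, hw, rfl⟩ := hw
  rw [Level.pr_scale] at h
  exact ⟨v, hv, w, hw, h⟩

theorem Fits.total_none (hl : l.Fits p x) (hr : r.Fits q y) (wx : x.Wf) {c : ℤ}
    (h : 2 * Level.pr x.level₀ y.level₀ ≤ c) :
    ((node l r).total none none : ℤ) ≤ (p * q : ℕ) * c := by
  have h1 := hl.cross_none hr wx
  rw [total_node, cross_comm r l]
  push_cast at h1 ⊢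
  nlinarith [mul_nonneg (Int.natCast_nonneg p) (Int.natCast_nonneg q)]

theorem Fits.total_left (hl : l.Fits p x) (hr : r.Fits q y) (wx : x.Wf) (wy : y.Wf) {c : ℤ}
    (h : ∀ v ∈ x.levels₁, ∀ w ∈ y.levels₁,
      Level.pr v y.level₀ + Level.pr w x.level₀ ≤ c) (s : ℕ) :
    ((node l r).total (some s) none : ℤ) ≤ (p * q : ℕ) * c := by
  obtain ⟨v, hv, h1⟩ := hl.cross_left hr wx s
  obtain ⟨w, hw, h2⟩ := hr.cross_left hl wy s
  have h3 := h v hv w hw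
  rw [total_node]
  push_cast at h1 h2 ⊢
  nlinarith [mul_nonneg (Int.natCast_nonneg p) (Int.natCast_nonneg q)]

theorem Fits.total_some (hl : l.Fits p x) (hr : r.Fits q y) (wx : x.Wf) {c : ℤ}
    (h : ∀ v ∈ x.levels₁, ∀ w ∈ y.levels₁, 2 * Level.pr v w ≤ c) (s s' : ℕ) :
    ((node l r).total (some s) (some s') : ℤ) ≤ (p * q : ℕ) * c := by
  obtain ⟨v, hv, w, hw, h1⟩ := hl.cross_some hr wx s s'
  obtain ⟨v', hv', w', hw', h2⟩ := hl.cross_some hr wx s' s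
  have h3 := h v hv w hw
  have h4 := h v' hv' w' hw'
  rw [total_node, cross_comm r l]
  push_cast at h1 h2 ⊢
  nlinarith [mul_nonneg (Int.natCast_nonneg p) (Int.natCast_nonneg q)]

theorem Fits.count_of_ev (hl : l.Fits p x) (hr : r.Fits q y) (wx : x.Wf)
    (hn : (node l r).ev = true) {c : ℤ} (h : Level.pr x.level₀ y.level₀ ≤ c) (b : Bool) :
    ((node l r).count b none none : ℤ) ≤ (p * q : ℕ) * c := by
  rw [count_node_of_ev hn]
  exact (hl.cross_none hr wx).trans (mul_le_mul_of_nonneg_left h (Int.natCast_nonneg _))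

theorem Fits.count_of_not_ev (hl : l.Fits p x) (hr : r.Fits q y)
    (hn : (node l r).ev = false) {c : ℤ} (h : 2 * x.M * y.M ≤ c) (b : Bool) :
    ((node l r).count b none none : ℤ) ≤ (p * q : ℕ) * c := by
  have key : ∃ b₁ b₂, (node l r).count b none none ≤
      2 * l.count b₁ none none * r.count b₂ none none := by
    simp only [ev] at hn
    by_cases h1 : l.ev = true
    · exact ⟨_, _, count_node_le h1 (by simpa [h1] using hn) b⟩
    · rw [count_node_comm]
      refine ⟨b, !b, (count_node_le ?_ (by simpa using h1) b).trans (le_of_eq (by ring))⟩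
      simpa [h1] using hn
  obtain ⟨b₁, b₂, h1⟩ := key
  have h2 : (l.count b₁ none none : ℤ) * r.count b₂ none none ≤ (p * x.M) * (q * y.M) :=
    mul_le_mul (hl.cnt b₁) (hr.cnt b₂) (Int.natCast_nonneg _)
      ((Int.natCast_nonneg _).trans (hl.cnt b₁))
  zify at h1
  push_cast
  nlinarith [mul_nonneg (Int.natCast_nonneg p) (Int.natCast_nonneg q)]

end node

end BTree

/-- The optimization problem behind `BTree.Fits.mix_of_special`. -/
theorem special_bound {p q A F E G D a f g k : ℤ} (l1 : 0 ≤ F) (l2 : F ≤ E) (l3 : E ≤ A)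
    (l4 : A ≤ 6 * p) (l5 : A + G ≤ 8 * p) (l6 : F + G ≤ 6 * p) (l7 : E + D ≤ 6 * p) (l8 : 0 ≤ D)
    (l9 : D ≤ G) (r1 : 0 ≤ f) (r2 : f ≤ a) (r3 : a ≤ 14 * q) (r4 : a + g ≤ 20 * q)
    (r5 : f + g ≤ 15 * q) (r6 : k ≤ g) (r7 : k ≤ 14 * q - 2 * f + a) (r8 : 0 ≤ k)
    (r9 : g ≤ 14 * q) :
    (A - F) * k + (2 * F + E) * g + 2 * a * G + f * D ≤ 252 * (p * q) := by
  have hm : ∀ {a b c d : ℤ}, a ≤ b → c ≤ d → 0 ≤ (b - a) * (d - c) :=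
    fun h h' => mul_nonneg (sub_nonneg.2 h) (sub_nonneg.2 h')
  rcases le_total g (2 * q) with y | y
  · linarith [hm l1 r6, hm l1 r8, hm l1 y, hm l5 r8, hm l6 r1, hm l6 r2,
      hm l6 r4, hm l6 r5, hm l6 r6, hm l7 r6, hm l7 r8, hm l8 r3,
      hm l8 r7, hm l8 r8, hm l9 r3, hm l9 r4, hm l9 r6, hm l9 r9]
  · linarith [hm l1 r9, hm l2 r9, hm l3 r4, hm l3 r6, hm l4 r3, hm l4 r8,
      hm l4 y, hm l5 r9, hm l6 r6, hm l6 r9, hm l6 y, hm l7 r1,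
      hm l7 r2, hm l7 r8, hm l8 r3, hm l8 r4, hm l8 r5, hm l8 r6,
      hm l9 r3, hm l9 r4, hm l9 r6, hm l9 r9]

theorem joinCount_eq_right (b : Bool) (X Y : Multiset ℕ) :
    joinCount b X Y = (Y.map fun y => X.countP (fun x => Step b x y)).sum := by
  unfold joinCount
  rw [Multiset.sum_map_sum_map]
  simp [sum_map_ite_eq_countP]

namespace BTree

theorem countP_firsts_le (t : BTree) (b : Bool) (s : ℕ) (p : Option ℕ) {P : ℕ → Prop}
    [DecidablePred P] (h : ∀ x, P x → Meets (some s) b x) :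
    (t.firsts b p).countP P ≤ t.count b (some s) p := by
  rw [← countP_firsts]
  exact countP_le_countP_of_imp fun x hx => by simpa [Meets] using h x hx

theorem count_mono {t : BTree} {b : Bool} {s s' : ℕ} (q : Option ℕ)
    (h : ∀ x, Meets (some s) b x → Meets (some s') b x) :
    t.count b (some s) q ≤ t.count b (some s') q := by
  rw [← countP_firsts t b s]
  exact countP_firsts_le _ _ _ _ fun x hx => h x (by simpa [Meets] using hx)

theorem joinCount_singleton_le (t : BTree) (b : Bool) (z : ℕ) (q : Option ℕ) :
    joinCount b {z} (t.firsts (!b) q) ≤ t.count (!b) (some z) q := by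
  simp only [joinCount, Multiset.map_singleton, Multiset.sum_singleton, sum_map_ite_eq_countP]
  refine countP_firsts_le _ _ _ _ fun x hx => ?_
  cases b <;> simp [Step, Meets] at hx ⊢ <;> omega

theorem joinCount_singleton_le' (t : BTree) (b : Bool) (z : ℕ) (q : Option ℕ) :
    joinCount b (t.firsts b q) {z} ≤ t.count b (some z) q := by
  rw [← joinCount_not]
  simpa using joinCount_singleton_le t (!b) z q

theorem firsts_leaf (z : ℕ) (b : Bool) (p : Option ℕ) :
    (leaf z).firsts b p = if Meets p b z then {z} else 0 := by
  simp [firsts, ends, endType, ev]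

theorem cross_leaf_le (z : ℕ) (r : BTree) (p q : Option ℕ) :
    cross (leaf z) r p q ≤ (if Meets p true z then r.count false (some z) q else 0) +
      (if Meets p false z then r.count true (some z) q else 0) := by
  have h1 := joinCount_singleton_le r true z q
  have h2 := joinCount_singleton_le' r true z q
  rw [Bool.not_true] at h1
  unfold cross crossCount
  rw [firsts_leaf, firsts_leaf]
  refine add_le_add ?_ ?_
  · split_ifs
    · exact h1
    · simp [joinCount]
  · split_ifs
    · exact h2
    · simp [joinCount]

theorem Fits.half_of_leaf_ev {z : ℕ} {r : BTree} {q : ℕ} {y : Profile} (hr : r.Fits q y) (s : ℕ) :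
    ((node (leaf z) r).total (some s) none : ℤ) ≤ q * y.J := by
  have h1 := cross_leaf_le z r (some s) none
  have h2 := cross_leaf_le z r none (some s)
  have h3 := hr.mix true z s
  have h4 := hr.mix false z s
  rw [total_node, cross_comm r]
  simp only [Meets, Option.mem_def, Option.some.injEq, forall_eq', if_true, Bool.false_eq_true,
    if_false] at h1
  simp only [meets_none, if_true] at h2
  rw [total] at h3 h4
  by_cases h : s ≤ z
  · simp only [h, if_true, not_lt.2 h, if_false] at h1
    push_cast at *
    omega
  · simp only [h, if_false, not_le.1 h, if_true] at h1
    push_cast at *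
    omega

theorem count_leaf_node_le (z : ℕ) {r : BTree} (hr : r.ev = false) (b : Bool) (s : ℕ) :
    (node (leaf z) r).count b (some s) none ≤
      (if Meets (some s) b z then r.count (!b) (some z) none else 0) +
        r.count b (some z) (some s) := by
  rw [count_node]
  simp only [endType, hr, ev, Bool.false_eq_true, if_false, firsts_leaf, meets_none, if_true]
  refine add_le_add ?_ (joinCount_singleton_le' _ _ _ _)
  split_ifs
  · exact joinCount_singleton_le _ _ _ _
  · simp [joinCount]

theorem Fits.mix_of_leaf_odd {z : ℕ} {r : BTree} {q : ℕ} {y : Profile} (hr : r.Fits q y)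
    (ho : r.ev = false) {c : ℤ} (hc1 : 2 * y.M + y.K ≤ c) (hc2 : 2 * y.H ≤ c) (b : Bool)
    (s s' : ℕ) :
    ((node (leaf z) r).count b (some s) none : ℤ) + (node (leaf z) r).total (some s) (some s') ≤
      q * c := by
  have hq : (0 : ℤ) ≤ q := Int.natCast_nonneg q
  have c1 : 2 * (q * y.M) + q * y.K ≤ q * c := by nlinarith
  have c2 : 2 * (q * y.H) ≤ q * c := by nlinarith
  have h1 := count_leaf_node_le z ho b s
  have h2 := cross_leaf_le z r (some s) (some s')
  have h3 := cross_leaf_le z r (some s') (some s)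
  have k1 := hr.half z
  have k2 := hr.full z s
  have k2' := hr.full z s'
  have k3 := (Int.ofNat_le.2 (count_le_count_none_left r true (some z) none)).trans (hr.cnt true)
  have k4 := (Int.ofNat_le.2 (count_le_count_none_left r false (some z) none)).trans (hr.cnt false)
  have m1 := count_le_count_none_right r true (some z) (some s)
  have m2 := count_le_count_none_right r false (some z) (some s)
  have m3 := count_le_count_none_right r true (some z) (some s')
  have m4 := count_le_count_none_right r false (some z) (some s')
  rw [total_node, cross_comm r]
  rw [total] at k1 k2 k2'
  simp only [Meets, Option.mem_def, Option.some.injEq, forall_eq', if_true, Bool.false_eq_true,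
    if_false] at h1 h2 h3
  by_cases e1 : s ≤ z <;> by_cases e2 : s' ≤ z <;> cases b <;>
    simp only [e1, e2, if_true, if_false, lt_iff_not_ge, not_true,
      not_false_eq_true, Bool.not_true, Bool.not_false, Bool.false_eq_true] at h1 h2 h3 <;>
    push_cast at * <;> omega

theorem cross_some_le (l r : BTree) (p q : Option ℕ) (b : Bool) :
    cross l r p q ≤ l.count b none p * r.count (!b) none q +
      r.count b none q * l.count (!b) none p := by
  have h1 := joinCount_le true (l.firsts true p) (r.firsts false q)
  have h2 := joinCount_le true (r.firsts true q) (l.firsts false p)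
  rw [card_firsts, card_firsts] at h1 h2
  unfold cross crossCount
  cases b
  · simp only [Bool.not_false]; linarith
  · simp only [Bool.not_true]; linarith

theorem count_node_some_le {l r : BTree} (hl : l.ev = false) (hr : r.ev = false) (b : Bool)
    (s : ℕ) : ((node l r).count b (some s) none : ℤ) ≤
      l.count b (some s) none * r.count (!b) none none +
      l.count (!b) (some s) none * r.count b (some s) none +
      (l.count (!b) none none - l.count (!b) (some s) none) * r.count b (some s) (some s) := by
  have e : ∀ b, r.count b none (some s) = r.count b (some s) none := fun b => by
    rw [← count_endType]; simp [endType, hr]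
  have e' : ∀ b, l.count b none (some s) = l.count b (some s) none := fun b => by
    rw [← count_endType]; simp [endType, hl]
  rw [count_node]
  simp only [endType, hl, hr, Bool.false_eq_true, if_false]
  have h1 := joinCount_le b (l.firsts b (some s)) (r.firsts (!b) none)
  rw [card_firsts, card_firsts, e'] at h1
  have h2 : joinCount b (r.firsts b (some s)) (l.firsts (!b) none) ≤
      ((l.firsts (!b) none).map fun y => (if Meets (some s) (!b) y then r.count b (some s) none
        else r.count b (some s) (some s))).sum := by
    rw [joinCount_eq_right]
    refine Multiset.sum_map_le_sum_map _ _ fun y _ => ?_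
    split_ifs with hy
    · rw [← e, ← card_firsts]
      exact Multiset.countP_le_card _ _
    · refine countP_firsts_le _ _ _ _ fun x hx => ?_
      cases b <;> simp [Step, Meets] at hx hy ⊢ <;> omega
  have h3 : ∀ (X : Multiset ℕ) (P : ℕ → Prop) (c d : ℕ),
      ((X.map fun y => if P y then c else d).sum : ℤ) =
        X.countP P * c + (X.card - X.countP P) * d := by
    intro X P c d
    induction X using Multiset.induction_on with
    | empty => simp
    | cons x X ih =>
      by_cases hx : P x <;> simp [hx, ih] <;> ring
  have h4 : (l.firsts (!b) none).countP (Meets (some s) (!b)) = l.count (!b) (some s) none := by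
    rw [← countP_firsts]
    exact Multiset.countP_congr rfl fun x _ => by simp [Meets]
  replace h2 := Int.ofNat_le.2 h2
  zify at h1
  rw [h3, h4, card_firsts] at h2
  push_cast
  linarith

theorem Fits.mix_of_special_aux {l r : BTree} {p q : ℕ} {x y : Profile} (hl : l.Fits p x)
    (hr : r.Fits q y) (ol : l.ev = false) (or : r.ev = false) (xM : 8 * x.M ≤ 6 * x.T)
    (xH : 8 * x.H ≤ 6 * x.T) (yM : 20 * y.M ≤ 14 * y.T) (yH : 20 * y.H ≤ 15 * y.T)
    (yK : 20 * y.K ≤ 14 * y.T) {c : ℤ} (hc : 252 * (x.T * y.T) ≤ 160 * c) (b : Bool)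
    (s s' : ℕ) (hs : ∀ x, Meets (some s') b x → Meets (some s) b x)
    (hs' : ∀ x, Meets (some s) (!b) x → Meets (some s') (!b) x) :
    ((node l r).count b (some s) none : ℤ) + (node l r).total (some s) (some s') ≤
      (p * q : ℕ) * c := by
  have e : ∀ b s, r.count b none (some s) = r.count b (some s) none := fun b s => by
    rw [← count_endType]; simp [endType, or]
  have e' : ∀ b s, l.count b none (some s) = l.count b (some s) none := fun b s => by
    rw [← count_endType]; simp [endType, ol]
  have h1 := count_node_some_le ol or b s
  have h2 := cross_some_le l r (some s) (some s') b
  have h3 := cross_some_le l r (some s') (some s) b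
  simp only [e, e'] at h2 h3
  have tot_eq : ∀ (t : BTree) p q, t.total p q = t.count b p q + t.count (!b) p q := by
    intro t p q; cases b <;> simp [total, add_comm]
  have hp : (0 : ℤ) ≤ p := Int.natCast_nonneg p
  have hq : (0 : ℤ) ≤ q := Int.natCast_nonneg q
  have u1 := hl.cnt (!b)
  have u2 := hl.tot
  have u3 := hl.half s
  have u4 := hl.half s'
  have v1 := hr.cnt (!b)
  have v2 := hr.tot
  have v3 := hr.half s
  have v4 := hr.full s s
  have v5 := hr.cnt b
  rw [tot_eq] at u2 u3 u4 v2 v3 v4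
  have w1 := count_le_count_none_left l b (some s) none
  have w2 := count_le_count_none_left l (!b) (some s') none
  have w3 := count_mono (t := l) none hs
  have w4 := count_mono (t := l) none hs'
  have w5 := count_le_count_none_left r b (some s) none
  have w6 := count_le_count_none_left r (!b) (some s) none
  have w7 := count_le_count_none_left r (!b) (some s') none
  have w8 := count_le_count_none_right r b (some s) (some s)
  have w9 := count_mono (t := r) none hs
  have incl : 2 * r.count (!b) (some s) none ≤
      r.count (!b) none none + r.count (!b) (some s) (some s) := by
    have : r.count (!b) (some s) none + r.count (!b) none (some s) ≤
        r.count (!b) none none + r.count (!b) (some s) (some s) := by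
      simp only [count, ← Multiset.sum_map_add]
      refine Multiset.sum_map_le_sum_map _ _ fun u _ => ?_
      by_cases h1 : Meets (some s) (!b) u.1 <;>
        by_cases h2 : Meets (some s) (r.endType (!b)) u.2 <;> simp [h1, h2]
    rw [e] at this
    omega
  rw [total_node, cross_comm r]
  have xM' := mul_le_mul_of_nonneg_left xM hp
  have xH' := mul_le_mul_of_nonneg_left xH hp
  have yM' := mul_le_mul_of_nonneg_left yM hq
  have yH' := mul_le_mul_of_nonneg_left yH hq
  have yK' := mul_le_mul_of_nonneg_left yK hq
  have hc' := mul_le_mul_of_nonneg_left hc (mul_nonneg hp hq)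
  zify at w1 w2 w3 w4 w5 w6 w7 w8 w9 incl h2 h3
  push_cast at u2 u3 u4 v2 v3 v4 ⊢
  have pos : ∀ n : ℕ, (0 : ℤ) ≤ n := Int.natCast_nonneg
  have n1 := pos (l.count (!b) (some s) none)
  have n2 := pos (l.count b (some s') none)
  have n3 := pos (r.count (!b) (some s) none)
  have n4 := pos (r.count b (some s) (some s))
  have n5 := mul_le_mul_of_nonneg_left w7 (pos (l.count b (some s) none))
  have n6 := mul_le_mul_of_nonneg_left w9 (pos (l.count (!b) (some s) none))
  have := special_bound (p := p * x.T) (q := q * y.T) (A := 8 * l.count (!b) none none)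
    (F := 8 * l.count (!b) (some s) none) (E := 8 * l.count (!b) (some s') none)
    (G := 8 * l.count b (some s) none) (D := 8 * l.count b (some s') none)
    (a := 20 * r.count (!b) none none) (f := 20 * r.count (!b) (some s) none)
    (g := 20 * r.count b (some s) none) (k := 20 * r.count b (some s) (some s))
    (by linarith) (by linarith) (by linarith) (by linarith) (by linarith) (by linarith)
    (by linarith) (by linarith) (by linarith) (by linarith) (by linarith) (by linarith)
    (by linarith) (by linarith) (by linarith) (by linarith) (by linarith) (by linarith)
  linarith

theorem Fits.mix_of_special {l r : BTree} {p q : ℕ} {x y : Profile} (hl : l.Fits p x)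
    (hr : r.Fits q y) (ol : l.ev = false) (or : r.ev = false) (xM : 8 * x.M ≤ 6 * x.T)
    (xH : 8 * x.H ≤ 6 * x.T) (yM : 20 * y.M ≤ 14 * y.T) (yH : 20 * y.H ≤ 15 * y.T)
    (yK : 20 * y.K ≤ 14 * y.T) {c : ℤ} (hc : 252 * (x.T * y.T) ≤ 160 * c) (b : Bool)
    (s s' : ℕ) :
    ((node l r).count b (some s) none : ℤ) + (node l r).total (some s) (some s') ≤
      (p * q : ℕ) * c := by
  have key := hl.mix_of_special_aux hr ol or xM xH yM yH yK hc b
  by_cases h : ∀ x, Meets (some s') b x → Meets (some s) b x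
  · refine key s s' h fun x hx => ?_
    by_contra hx'
    have := h s
    have := h x
    cases b <;> simp [Meets] at * <;> omega
  · have h1 : ∀ x, Meets (some s) b x → Meets (some s') b x := by
      intro x hx
      push Not at h
      obtain ⟨y, hy, hy'⟩ := h
      cases b <;> simp [Meets] at * <;> omega
    have h2 := key s' s h1 fun x hx => by
      by_contra hx'
      push Not at h
      obtain ⟨y, hy, hy'⟩ := h
      cases b <;> simp [Meets] at * <;> omega
    have h3 := count_mono (t := node l r) none h1
    rw [total_comm] at h2
    omega

end BTree

namespace Profile

/-- Multiply a profile by a natural number. -/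
def scale (s : ℕ) (x : Profile) : Profile := ⟨s * x.T, s * x.M, s * x.H, s * x.K, s * x.J⟩

/-- Hypotheses of `BTree.Fits.mix_of_special`. -/
def Special (x y : Profile) (c : ℤ) : Prop :=
  8 * x.M ≤ 6 * x.T ∧ 8 * x.H ≤ 6 * x.T ∧ 20 * y.M ≤ 14 * y.T ∧ 20 * y.H ≤ 15 * y.T ∧
    20 * y.K ≤ 14 * y.T ∧ 252 * (x.T * y.T) ≤ 160 * c

instance (x y : Profile) (c : ℤ) : Decidable (x.Special y c) := by unfold Special; infer_instance

/-- Sufficient conditions for a node to have profile `z` when its subtrees have profiles `x` and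
`y`, where the numbers of leaves are `a` and `b` up to replacing numbers other than `1` by larger
ones of the same parity. -/
def Compat (a b : ℕ) (x y z : Profile) : Prop :=
  x.Wf ∧ y.Wf ∧ 2 * Level.pr x.level₀ y.level₀ ≤ z.T ∧
  (if (a + b) % 2 = 0 then Level.pr x.level₀ y.level₀ ≤ z.M else 2 * x.M * y.M ≤ z.M) ∧
  ((a = 1 ∧ b % 2 = 0 ∧ y.J ≤ z.H) ∨
    ∀ v ∈ x.levels₁, ∀ w ∈ y.levels₁,
      Level.pr v y.level₀ + Level.pr w x.level₀ ≤ z.H) ∧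
  (∀ v ∈ x.levels₁, ∀ w ∈ y.levels₁, 2 * Level.pr v w ≤ z.K) ∧
  (z.M + z.K ≤ z.J ∨
    ((a + b) % 2 = 0 ∧ ∀ v ∈ x.levels₁, ∀ w ∈ y.levels₁,
      Level.pr x.level₀ y.level₀ + 2 * Level.pr v w ≤ z.J) ∨
    (a = 1 ∧ b % 2 = 1 ∧ 2 * y.M + y.K ≤ z.J ∧ 2 * y.H ≤ z.J) ∨
    (a % 2 = 1 ∧ b % 2 = 1 ∧ (x.Special y z.J ∨ y.Special x z.J)))

instance (a b : ℕ) (x y z : Profile) : Decidable (Compat a b x y z) := by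
  unfold Compat; infer_instance

/-- The profile of a tree with an odd number of leaves. -/
def odd (S M H K : ℤ) : Profile := ⟨S, M, H, K, M + K⟩

/-- The profile of a tree with an even number of leaves. -/
def even (e H K J : ℤ) : Profile := ⟨2 * e, e, H, K, J⟩

/-- Profiles such that every tree with `n` leaves fits one of them. -/
def table : ℕ → List Profile
  | 1 => [odd 2 1 1 1]
  | 2 => [even 1 2 2 3]
  | 3 => [odd 4 2 3 2]
  | 4 => [even 3 4 4 6]
  | 5 => [odd 8 4 7 6, odd 8 6 6 6]
  | 6 => [even 6 12 12 18, even 7 10 8 15]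
  | 7 => [odd 20 14 15 14, odd 24 12 18 12]
  | 8 => [even 18 24 24 36, even 15 28 28 42]
  | 9 => [odd 48 24 42 36, odd 56 30 42 30, odd 48 36 36 36]
  | 10 => [even 36 72 72 108, even 42 60 60 90]
  | 11 => [odd 116 60 99 84, odd 120 84 90 84, odd 144 72 108 72]
  | 12 => [even 108 144 144 216, even 98 144 120 218, even 90 168 168 252]
  | 13 => [odd 288 196 218 196, odd 288 216 216 216, odd 336 180 252 180, odd 288 144 252 216]
  | 14 => [even 252 360 360 540, even 216 432 432 648, even 218 392 392 588]
  | 15 => [odd 644 364 545 465, odd 864 432 648 432, odd 696 360 594 504, odd 720 504 540 504,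
      odd 784 436 588 436]
  | 16 => [even 540 1008 1008 1512, even 588 872 872 1308, even 648 864 864 1296]
  | 17 => [odd 1728 1296 1296 1296, odd 1728 864 1512 1296, odd 2016 1080 1512 1080,
      odd 1744 1176 1308 1176, odd 1656 872 1394 1176, odd 1624 900 1390 1188]
  | _ => []

/-- Representative below `18` of a number of leaves, modulo the period `4` of the table. -/
def red (n : ℕ) : ℕ := if n < 18 then n else 14 + (n - 14) % 4

/-- Number of periods removed by `red`. -/
def periods (n : ℕ) : ℕ := if n < 18 then 0 else (n - 14) / 4

theorem red_add (a b : ℕ) : red (a + b) = red (red a + red b) := by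
  unfold red
  split_ifs <;> omega

theorem periods_add (a b : ℕ) :
    periods (a + b) = periods a + periods b + periods (red a + red b) := by
  unfold red periods
  split_ifs <;> omega

theorem red_lt (n : ℕ) : red n < 18 := by
  unfold red
  split_ifs <;> omega

theorem red_mod_two (n : ℕ) : red n % 2 = n % 2 := by
  unfold red
  split_ifs <;> omega

theorem red_eq_one {n : ℕ} : red n = 1 ↔ n = 1 := by
  unfold red
  split_ifs <;> omega

theorem table_closed : ∀ a < 18, ∀ b < 18, a ≤ b → ∀ x ∈ table a, ∀ y ∈ table b,
    ∃ z ∈ table (red (a + b)), Compat a b x y (z.scale (6 ^ periods (a + b))) := by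
  decide +kernel

end Profile

namespace BTree

open Profile

theorem Fits.of_scale {t : BTree} {p s : ℕ} {x : Profile} (h : t.Fits p (x.scale s)) :
    t.Fits (p * s) x := by
  obtain ⟨h1, h2, h3, h4, h5⟩ := h
  simp only [scale, ← mul_assoc] at h1 h2 h3 h4 h5
  exact ⟨by push_cast; exact h1, by push_cast; exact h2, by push_cast; exact h3,
    by push_cast; exact h4, by push_cast; exact h5⟩

theorem ev_eq_true_iff (t : BTree) : t.ev = true ↔ t.leaves.length % 2 = 0 := by
  rw [ev_eq, decide_eq_true_iff, Nat.even_iff]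

theorem ev_eq_false_iff (t : BTree) : t.ev = false ↔ t.leaves.length % 2 = 1 := by
  rw [ev_eq, decide_eq_false_iff_not, Nat.not_even_iff]

theorem eq_leaf_of_length_leaves : ∀ {t : BTree}, t.leaves.length = 1 → ∃ z, t = leaf z
  | leaf z, _ => ⟨z, rfl⟩
  | node l r, h => by
    have h1 := length_leaves_pos l
    have h2 := length_leaves_pos r
    simp only [leaves, List.length_append] at h
    omega

theorem Fits.node {l r : BTree} {p q a b : ℕ} {x y z : Profile} (hl : l.Fits p x) (hr : r.Fits q y)
    (ha : l.leaves.length % 2 = a % 2) (hb : r.leaves.length % 2 = b % 2)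
    (h1 : a = 1 → l.leaves.length = 1 ∧ p = 1) (h : Compat a b x y z) :
    (node l r).Fits (p * q) z := by
  obtain ⟨wx, wy, hT, hM, hH, hK, hJ⟩ := h
  have hn : (BTree.node l r).leaves.length % 2 = (a + b) % 2 := by
    simp only [leaves, List.length_append]
    omega
  have hcnt : ∀ c, ((BTree.node l r).count c none none : ℤ) ≤ (p * q : ℕ) * z.M := by
    split_ifs at hM with h0
    · exact hl.count_of_ev hr wx ((ev_eq_true_iff _).2 (hn.trans h0)) hM
    · exact hl.count_of_not_ev hr ((ev_eq_false_iff _).2 (by omega)) hM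
  have hfull := hl.total_some hr wx hK
  refine ⟨hl.total_none hr wx hT, hcnt, fun s => ?_, hfull, fun c s s' => ?_⟩
  · rcases hH with ⟨ha1, hb0, hc⟩ | hH
    · obtain ⟨hl1, rfl⟩ := h1 ha1
      obtain ⟨u, rfl⟩ := eq_leaf_of_length_leaves hl1
      rw [one_mul]
      exact (hr.half_of_leaf_ev s).trans (by gcongr)
    · exact hl.total_left hr wx wy hH s
  · have e3 : ((BTree.node l r).count c (some s) none : ℤ) ≤
        (BTree.node l r).count c none none := by
      exact_mod_cast count_le_count_none_left _ _ _ _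
    rcases hJ with hc | ⟨h0, hc⟩ | ⟨ha1, hb1, hc1, hc2⟩ | ⟨ha1, hb1, hc⟩
    · have e1 := hcnt c
      have e2 := hfull s s'
      calc _ ≤ ((p * q : ℕ) : ℤ) * (z.M + z.K) := by linarith
        _ ≤ _ := by gcongr
    · have e1 := hl.count_of_ev hr wx ((ev_eq_true_iff _).2 (hn.trans h0)) le_rfl c
      have e2 := hl.total_some hr wx (c := z.J - Level.pr x.level₀ y.level₀)
        (fun v hv w hw => by linarith [hc v hv w hw]) s s'
      linarith
    · obtain ⟨hl1, rfl⟩ := h1 ha1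
      obtain ⟨u, rfl⟩ := eq_leaf_of_length_leaves hl1
      rw [one_mul]
      exact hr.mix_of_leaf_odd ((ev_eq_false_iff _).2 (by omega)) hc1 hc2 c s s'
    · have ol := (ev_eq_false_iff l).2 (by omega)
      have or := (ev_eq_false_iff r).2 (by omega)
      rcases hc with ⟨c1, c2, c3, c4, c5, c6⟩ | ⟨c1, c2, c3, c4, c5, c6⟩
      · exact hl.mix_of_special hr ol or c1 c2 c3 c4 c5 c6 c s s'
      · have := hr.mix_of_special hl or ol c1 c2 c3 c4 c5 c6 c s s'
        rwa [count_node_comm, total_node, add_comm (cross _ _ _ _), ← total_node,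
          mul_comm q] at this

theorem exists_fits (t : BTree) : ∃ x ∈ table (red t.leaves.length),
    t.Fits (6 ^ periods t.leaves.length) x := by
  induction t with
  | leaf z => exact ⟨_, List.mem_singleton_self _, fits_leaf z⟩
  | node l r hl hr =>
    obtain ⟨x, hx, hl⟩ := hl
    obtain ⟨y, hy, hr⟩ := hr
    have key : ∀ {l r : BTree} {x y}, x ∈ table (red l.leaves.length) →
        y ∈ table (red r.leaves.length) → l.Fits (6 ^ periods l.leaves.length) x →
        r.Fits (6 ^ periods r.leaves.length) y → red l.leaves.length ≤ red r.leaves.length →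
        ∃ z ∈ table (red (l.leaves.length + r.leaves.length)),
          (node l r).Fits (6 ^ periods (l.leaves.length + r.leaves.length)) z := by
      intro l r x y hx hy hl hr hle
      obtain ⟨z, hz, h⟩ := table_closed _ (red_lt _) _ (red_lt _) hle x hx y hy
      rw [← red_add] at hz
      refine ⟨z, hz, ?_⟩
      rw [periods_add, pow_add, pow_add]
      refine (hl.node hr (red_mod_two _).symm (red_mod_two _).symm (fun h1 => ?_) h).of_scale
      rw [red_eq_one] at h1
      exact ⟨h1, by rw [h1]; rfl⟩
    rw [leaves, List.length_append]
    rcases le_total (red l.leaves.length) (red r.leaves.length) with h | h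
    · exact key hx hy hl hr h
    · obtain ⟨z, hz, h⟩ := key hy hx hr hl h
      rw [add_comm] at hz h
      exact ⟨z, hz, h.comm⟩

theorem altCount_le_total (t : BTree) : altCount t ≤ t.total none none := by
  have h : ∀ b, (t.words.filter fun w => Zig b w).card ≤ t.count b none none := fun b => by
    have := t.sum_words_le b fun _ _ => 1
    simpa [count] using this
  refine le_trans ?_ (add_le_add (h true) (h false))
  rw [altCount]
  simp only [isAlternating_iff]
  rw [Finset.filter_or]
  exact Finset.card_union_le _ _

theorem altCount_le (t : BTree) {v : ℕ} (h : ∀ x ∈ table (red t.leaves.length), x.T ≤ v) :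
    altCount t ≤ 6 ^ periods t.leaves.length * v := by
  obtain ⟨x, hx, ht⟩ := t.exists_fits
  have h1 := t.altCount_le_total
  have h2 := ht.tot
  have h3 := h x hx
  zify at h1 ⊢
  push_cast at h2
  refine h1.trans (h2.trans ?_)
  gcongr

end BTree

/-- Boolean version of `Zig`. -/
def zigTest : Bool → List ℕ → Bool
  | b, x :: y :: l => decide (Step b x y) && zigTest (!b) (y :: l)
  | _, _ => true

theorem zigTest_iff : ∀ {b : Bool} {w : List ℕ}, zigTest b w = true ↔ Zig b w
  | _, [] => by simp [zigTest, Zig]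
  | _, [_] => by simp [zigTest, Zig]
  | b, x :: y :: l => by
    rw [zig_cons_cons, zigTest, Bool.and_eq_true, decide_eq_true_iff, zigTest_iff]

theorem zig_map_add (k : ℕ) : ∀ {b : Bool} {w : List ℕ}, Zig b (w.map (k + ·)) ↔ Zig b w
  | _, [] => by simp [Zig]
  | _, [_] => by simp [Zig]
  | b, x :: y :: l => by
    have := zig_map_add k (b := !b) (w := y :: l)
    simp only [List.map_cons] at this ⊢
    rw [zig_cons_cons, zig_cons_cons, this]
    cases b <;> simp [Step]

/-- A word of odd length starting with a peak may replace a single peak below all its letters. -/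
theorem Zig.insert {v post : List ℕ} {m : ℕ} (hv : Zig true v) (ho : Odd v.length)
    (hm : ∀ x ∈ v, m ≤ x) : ∀ {b : Bool} {pre : List ℕ}, (Even pre.length ↔ b = true) →
    Zig b (pre ++ m :: post) → Zig b (pre ++ v ++ post)
  | b, [], hb, h => by
    obtain rfl : b = true := by simpa using hb
    have hne : v ≠ [] := by rintro rfl; simp at ho
    cases post with
    | nil => simpa using hv
    | cons y post =>
      rw [List.nil_append, zig_cons_cons] at h
      have ht : lastType true v.length = true := by
        simp [lastType, ho]
      rw [List.nil_append, zig_append hne (by simp), ht]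
      refine ⟨hv, h.2, ?_⟩
      have h1 := hm _ (List.getLast_mem hne)
      have h2 := h.1
      simp only [Step, if_true, List.headD_cons, List.getLastD_eq_getLast?,
        List.getLast?_eq_some_getLast hne, Option.getD_some] at h2 ⊢
      omega
  | b, [p], hb, h => by
    obtain rfl : b = false := by simpa using hb
    rw [List.singleton_append, zig_cons_cons] at h
    obtain ⟨x, v, rfl⟩ := List.exists_cons_of_ne_nil (show v ≠ [] by rintro rfl; simp at ho)
    have := Zig.insert hv ho hm (b := true) (pre := []) (by simp) h.2
    simp only [List.nil_append, List.cons_append] at this ⊢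
    rw [zig_cons_cons]
    refine ⟨?_, this⟩
    have h1 := hm x (by simp)
    have h2 := h.1
    simp only [Step, Bool.false_eq_true, if_false] at h2 ⊢
    omega
  | b, p :: q :: pre, hb, h => by
    simp only [List.cons_append] at h ⊢
    rw [zig_cons_cons] at h ⊢
    refine ⟨h.1, Zig.insert hv ho hm (b := !b) (pre := q :: pre) ?_ h.2⟩
    rw [List.length_cons, Nat.even_add_one] at hb
    cases b <;> simp at hb ⊢ <;> assumption

namespace BTree

/-- Add `k` to all labels. -/
def shift (k : ℕ) : BTree → BTree
  | leaf a => leaf (k + a)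
  | node l r => node (l.shift k) (r.shift k)

theorem leaves_shift (k : ℕ) (t : BTree) : (t.shift k).leaves = t.leaves.map (k + ·) := by
  induction t with
  | leaf a => rfl
  | node l r hl hr => simp [shift, leaves, hl, hr]

theorem map_mem_words_shift (k : ℕ) {t : BTree} : ∀ {w : List ℕ}, w ∈ t.words →
    w.map (k + ·) ∈ (t.shift k).words := by
  induction t with
  | leaf a => intro w hw; simp only [words, Finset.mem_singleton] at hw; simp [hw, shift, words]
  | node l r hl hr =>
    intro w hw
    simp only [words, shift, Finset.mem_union, Finset.mem_image, Finset.mem_product,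
      Prod.exists] at hw ⊢
    rcases hw with ⟨u, v, ⟨hu, hv⟩, rfl⟩ | ⟨u, v, ⟨hu, hv⟩, rfl⟩
    · exact Or.inl ⟨_, _, ⟨hl hu, hr hv⟩, by simp⟩
    · exact Or.inr ⟨_, _, ⟨hl hu, hr hv⟩, by simp⟩

theorem perm_leaves_of_mem_words {t : BTree} : ∀ {w : List ℕ}, w ∈ t.words → w.Perm t.leaves := by
  induction t with
  | leaf a => intro w hw; simp only [words, Finset.mem_singleton] at hw; simp [hw, leaves]
  | node l r hl hr =>
    intro w hw
    simp only [words, Finset.mem_union, Finset.mem_image, Finset.mem_product, Prod.exists] at hw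
    rcases hw with ⟨u, v, ⟨hu, hv⟩, rfl⟩ | ⟨u, v, ⟨hu, hv⟩, rfl⟩
    · exact (hl hu).append (hr hv)
    · exact List.perm_append_comm.trans ((hl hu).append (hr hv))

/-- Bracket `t` successively with the leaves labeled by the entries of a list. -/
def attach (ls : List ℕ) (t : BTree) : BTree := ls.foldr (fun a t => node (leaf a) t) t

theorem leaves_attach (ls : List ℕ) (t : BTree) : (attach ls t).leaves = ls ++ t.leaves := by
  induction ls with
  | nil => rfl
  | cons a ls ih => simpa [attach, leaves] using ih

/-- The pairs of words surrounding a word of `t` in the words of `attach ls t`. -/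
def contexts : List ℕ → List (List ℕ × List ℕ)
  | [] => [([], [])]
  | a :: ls => (contexts ls).map (fun c => (a :: c.1, c.2)) ++
      (contexts ls).map fun c => (c.1, c.2 ++ [a])

theorem mem_words_attach {t : BTree} {v : List ℕ} (hv : v ∈ t.words) :
    ∀ {ls : List ℕ} {c : List ℕ × List ℕ}, c ∈ contexts ls → c.1 ++ v ++ c.2 ∈ (attach ls t).words
  | [], c, hc => by
    simp only [contexts, List.mem_singleton] at hc
    simpa [hc, attach] using hv
  | a :: ls, c, hc => by
    simp only [contexts, List.mem_append, List.mem_map] at hc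
    have ih := @mem_words_attach t v hv ls
    simp only [attach, List.foldr_cons, words, Finset.mem_union, Finset.mem_image,
      Finset.mem_product, Prod.exists, Finset.mem_singleton]
    rcases hc with ⟨d, hd, rfl⟩ | ⟨d, hd, rfl⟩
    · exact Or.inl ⟨[a], _, ⟨rfl, ih hd⟩, by simp⟩
    · exact Or.inr ⟨[a], _, ⟨rfl, ih hd⟩, by simp⟩

/-- The number of words starting with a peak. -/
noncomputable def peakCount (t : BTree) : ℕ := (t.words.filter (Zig true)).card

theorem append_cancel {k : ℕ} {a a' v v' c c' : List ℕ} (ha : ∀ x ∈ a, x ≤ k)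
    (ha' : ∀ x ∈ a', x ≤ k)
    (hv : ∀ x ∈ v, k < x) (hv' : ∀ x ∈ v', k < x) (hc : ∀ x ∈ c, x ≤ k) (hc' : ∀ x ∈ c', x ≤ k)
    (hn : v ≠ []) (hn' : v' ≠ [])
    (h : a ++ v ++ c = a' ++ v' ++ c') : a = a' ∧ c = c' ∧ v = v' := by
  have h1 := congrArg (List.takeWhile (· ≤ k)) h
  have h2 := congrArg (List.filter (k < ·)) h
  have e1 : ∀ {v c : List ℕ}, (∀ x ∈ v, k < x) → v ≠ [] →
      (v ++ c).takeWhile (fun x => decide (x ≤ k)) = [] := by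
    intro v c hv hn
    obtain ⟨x, v, rfl⟩ := List.exists_cons_of_ne_nil hn
    have := hv x (by simp)
    simp [this]
  have e2 : ∀ {l : List ℕ}, (∀ x ∈ l, x ≤ k) → l.filter (fun x => decide (k < x)) = [] := by
    intro l hl
    simpa using hl
  have e3 : ∀ {l : List ℕ}, (∀ x ∈ l, k < x) → l.filter (fun x => decide (k < x)) = l := by
    intro l hl
    simpa using hl
  rw [List.append_assoc, List.append_assoc,
    List.takeWhile_append_of_pos (l₁ := a) (by simpa using ha),
    List.takeWhile_append_of_pos (l₁ := a') (by simpa using ha'), e1 hv hn, e1 hv' hn',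
    List.append_nil, List.append_nil] at h1
  simp only [List.filter_append, e2 ha, e2 ha', e2 hc, e2 hc', e3 hv, e3 hv', List.nil_append,
    List.append_nil] at h2
  subst h1 h2
  simpa using h

/-- The contexts which produce alternating words. -/
def peakContexts (ls : List ℕ) : List (List ℕ × List ℕ) :=
  (contexts ls).filter fun c =>
    zigTest (decide (Even c.1.length)) (c.1 ++ (ls.length + 1) :: c.2)

theorem length_mul_peakCount_le {t : BTree} {ls : List ℕ} {C : List (List ℕ × List ℕ)}
    {Q : List ℕ → Prop} (ho : Odd t.leaves.length) (hp : ∀ x ∈ t.leaves, 0 < x)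
    (hC : C ⊆ peakContexts ls) (hd : C.Nodup)
    (hl : ∀ c ∈ contexts ls, ∀ x ∈ c.1 ++ c.2, x ≤ ls.length)
    (hQ : ∀ c ∈ C, ∀ w, Zig (decide (Even c.1.length)) w → Q w) :
    C.length * t.peakCount ≤ ((attach ls (t.shift ls.length)).words.filter Q).card := by
  rw [← List.toFinset_card_of_nodup hd, peakCount, ← Finset.card_product]
  have hmem : ∀ {c}, c ∈ C → c ∈ contexts ls ∧
      Zig (decide (Even c.1.length)) (c.1 ++ (ls.length + 1) :: c.2) := fun hc => by
    have := hC hc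
    rw [peakContexts, List.mem_filter, zigTest_iff] at this
    exact this
  have hw : ∀ {w}, w ∈ t.words → Odd w.length ∧ ∀ x ∈ w.map (ls.length + ·), ls.length < x := by
    intro w hw
    have := perm_leaves_of_mem_words hw
    refine ⟨this.length_eq ▸ ho, fun x hx => ?_⟩
    obtain ⟨y, hy, rfl⟩ := List.mem_map.1 hx
    have := hp y (this.mem_iff.1 hy)
    omega
  refine Finset.card_le_card_of_injOn (fun p => p.1.1 ++ p.2.map (ls.length + ·) ++ p.1.2) ?_ ?_
  · rintro ⟨c, w⟩ h
    simp only [Finset.coe_product, Set.mem_prod, Finset.mem_coe, List.mem_toFinset,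
      Finset.mem_filter] at h ⊢
    obtain ⟨hc, hw1, hw2⟩ := h
    obtain ⟨hc1, hc2⟩ := hmem hc
    obtain ⟨hw3, hw4⟩ := hw hw1
    refine ⟨mem_words_attach (map_mem_words_shift _ hw1) hc1, hQ c hc _ ?_⟩
    exact Zig.insert ((zig_map_add _).2 hw2) (by simpa using hw3) hw4 (by simp) hc2
  · rintro ⟨c, w⟩ h ⟨c', w'⟩ h' he
    simp only [Finset.coe_product, Set.mem_prod, Finset.mem_coe, List.mem_toFinset,
      Finset.mem_filter] at h h' he
    have hne : ∀ {w}, w ∈ t.words → w.map (ls.length + ·) ≠ [] := fun h h0 => by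
      have := (hw h).1
      rw [List.map_eq_nil_iff.1 h0] at this
      simp at this
    have k1 := hl c (hmem h.1).1
    have k2 := hl c' (hmem h'.1).1
    simp only [List.mem_append] at k1 k2
    obtain ⟨e1, e2, e3⟩ := append_cancel (fun x hx => k1 x (Or.inl hx))
      (fun x hx => k2 x (Or.inl hx)) (hw h.2.1).2 (hw h'.2.1).2 (fun x hx => k1 x (Or.inr hx))
      (fun x hx => k2 x (Or.inr hx)) (hne h.2.1) (hne h'.2.1) he
    have e4 : w = w' := List.map_injective_iff.2 (add_right_injective _) e3
    simp [Prod.ext_iff, e1, e2, e4]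

/-- The labels of `t` are `1, …, n`. -/
def Labeled (t : BTree) (n : ℕ) : Prop := t.leaves.Perm (List.range' 1 n)

theorem Labeled.attach {t : BTree} {n : ℕ} (h : t.Labeled n) {ls : List ℕ}
    (hl : ls.Perm (List.range' 1 ls.length)) :
    (attach ls (t.shift ls.length)).Labeled (n + ls.length) := by
  rw [Labeled, leaves_attach, leaves_shift, add_comm n, ← List.range'_append_1]
  refine hl.append ((h.map _).trans ?_)
  rw [List.map_add_range', add_comm]

theorem Labeled.length_eq {t : BTree} {n : ℕ} (h : t.Labeled n) : t.leaves.length = n := by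
  rw [List.Perm.length_eq h, List.length_range']

theorem Labeled.altCount_attach {t : BTree} {n : ℕ} (h : t.Labeled n) (ho : Odd n) {ls : List ℕ}
    (hd : (peakContexts ls).Nodup)
    (hl : ∀ c ∈ contexts ls, ∀ x ∈ c.1 ++ c.2, x ≤ ls.length) :
    (peakContexts ls).length * t.peakCount ≤ altCount (BTree.attach ls (t.shift ls.length)) := by
  refine length_mul_peakCount_le (h.length_eq.symm ▸ ho) (fun x hx => ?_) (List.Subset.refl _) hd hl
    fun c _ w hw => ?_
  · have := h.mem_iff.1 hx
    simp only [List.mem_range'_1] at this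
    omega
  · rw [isAlternating_iff]
    cases hc : decide (Even c.1.length) <;> rw [hc] at hw
    · exact Or.inr hw
    · exact Or.inl hw

theorem exists_labeled_add_four {t : BTree} {n : ℕ} (h : t.Labeled n) (ho : Odd n) :
    ∃ t' : BTree, t'.Labeled (n + 4) ∧ 6 * t.peakCount ≤ t'.peakCount := by
  refine ⟨_, h.attach (ls := [4, 2, 3, 1]) (by decide), ?_⟩
  refine length_mul_peakCount_le (h.length_eq.symm ▸ ho) (fun x hx => ?_)
    (C := (peakContexts [4, 2, 3, 1]).filter fun c => decide (Even c.1.length))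
    (fun _ h => List.mem_of_mem_filter h) (by decide +kernel) (by decide +kernel)
    fun c hc w hw => ?_
  · have := h.mem_iff.1 hx
    simp only [List.mem_range'_1] at this
    omega
  · rwa [(List.mem_filter.1 hc).2] at hw

theorem exists_labeled_add_mul_four {t : BTree} {n : ℕ} (h : t.Labeled n) (ho : Odd n) (k : ℕ) :
    ∃ t' : BTree, t'.Labeled (n + 4 * k) ∧ t.peakCount * 6 ^ k ≤ t'.peakCount := by
  induction k with
  | zero => exact ⟨t, h, by simp⟩
  | succ k ih =>
    obtain ⟨t₁, h₁, e₁⟩ := ih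
    obtain ⟨t₂, h₂, e₂⟩ := exists_labeled_add_four h₁ (ho.add_even ⟨2 * k, by ring⟩)
    refine ⟨t₂, h₂, le_trans ?_ e₂⟩
    rw [pow_succ]
    linarith

/-- The list of words of a tree. -/
def wordList : BTree → List (List ℕ)
  | leaf a => [[a]]
  | node l r => l.wordList.flatMap fun u => r.wordList.flatMap fun v => [u ++ v, v ++ u]

theorem mem_words_of_mem_wordList {t : BTree} : ∀ {w : List ℕ}, w ∈ t.wordList → w ∈ t.words := by
  induction t with
  | leaf a => intro w hw; simpa [words, wordList] using hw
  | node l r hl hr =>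
    intro w hw
    simp only [wordList, List.mem_flatMap, List.mem_cons, List.not_mem_nil, or_false] at hw
    simp only [words, Finset.mem_union, Finset.mem_image, Finset.mem_product, Prod.exists]
    obtain ⟨u, hu, v, hv, rfl | rfl⟩ := hw
    · exact Or.inl ⟨u, v, ⟨hl hu, hr hv⟩, rfl⟩
    · exact Or.inr ⟨u, v, ⟨hl hu, hr hv⟩, rfl⟩

theorem length_filter_wordList_le {t : BTree} {q : List ℕ → Bool} {Q : List ℕ → Prop}
    (hq : ∀ w, q w = true → Q w) (hd : (t.wordList.filter q).Nodup) :
    (t.wordList.filter q).length ≤ (t.words.filter Q).card := by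
  rw [← List.toFinset_card_of_nodup hd]
  refine Finset.card_le_card fun w hw => ?_
  rw [List.mem_toFinset, List.mem_filter] at hw
  exact Finset.mem_filter.2 ⟨mem_words_of_mem_wordList hw.1, hq w hw.2⟩

/-- A tree with `6` leaves and `14` alternating words. -/
def tree₆ : BTree :=
  node (node (leaf 3) (node (leaf 1) (leaf 5))) (node (leaf 4) (node (leaf 2) (leaf 6)))

theorem le_altCount_tree₆ : 14 ≤ altCount tree₆ := by
  refine le_trans ?_ (length_filter_wordList_le (q := fun w => zigTest true w || zigTest false w)
    (fun w hw => ?_) (by decide +kernel))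
  · decide +kernel
  · rwa [isAlternating_iff, ← zigTest_iff, ← zigTest_iff, ← Bool.or_eq_true]

theorem le_peakCount_node_tree₆ : 14 ≤ (node (leaf 7) tree₆).peakCount := by
  refine le_trans ?_ (length_filter_wordList_le (q := zigTest true)
    (fun w hw => zigTest_iff.1 hw) (by decide +kernel))
  decide +kernel

end BTree

namespace BTree

open Profile

theorem rAlt_eq_of_le {n m : ℕ} {t : BTree} (ht : t.Labeled n) (hm : m ≤ altCount t)
    (h : ∀ t : BTree, t.Labeled n → altCount t ≤ m) : rAlt n = m :=
  le_antisymm (csSup_le ⟨_, t, ht, rfl⟩ (by rintro _ ⟨t, ht, rfl⟩; exact h t ht))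
    (hm.trans (le_csSup ⟨m, by rintro _ ⟨t, ht, rfl⟩; exact h t ht⟩ ⟨t, ht, rfl⟩))

theorem rAlt_eq {n m : ℕ} {t : BTree} (ht : t.Labeled n) (hm : m ≤ altCount t) (v : ℕ)
    (hv : ∀ x ∈ table (red n), x.T ≤ v) (h : 6 ^ periods n * v ≤ m) : rAlt n = m :=
  rAlt_eq_of_le ht hm fun t ht => by
    rw [← ht.length_eq] at hv h
    exact (t.altCount_le hv).trans h

theorem altCount_leaf (z : ℕ) : altCount (leaf z) = 1 := by
  have : IsAlternating [z] := isAlternating_iff.2 (Or.inl trivial)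
  rw [altCount, words, Finset.filter_singleton, if_pos this, Finset.card_singleton]

theorem labeled_leaf : (leaf 1).Labeled 1 := List.Perm.refl _

theorem peakCount_leaf (z : ℕ) : (leaf z).peakCount = 1 := by
  have : Zig true [z] := trivial
  rw [peakCount, words, Finset.filter_singleton, if_pos this, Finset.card_singleton]

theorem rAlt_one : rAlt 1 = 1 := by
  refine rAlt_eq_of_le labeled_leaf (altCount_leaf 1).ge fun t ht => ?_
  obtain ⟨z, rfl⟩ := eq_leaf_of_length_leaves ht.length_eq
  exact (altCount_leaf z).le

theorem Labeled.exists_altCount {t : BTree} {n a m : ℕ} (h : t.Labeled n) (ho : Odd n)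
    (ha : a ≤ t.peakCount) {ls : List ℕ} (hm : (peakContexts ls).length = m)
    (hp : ls.Perm (List.range' 1 ls.length)) (hd : (peakContexts ls).Nodup)
    (hl : ∀ c ∈ contexts ls, ∀ x ∈ c.1 ++ c.2, x ≤ ls.length) :
    ∃ t' : BTree, t'.Labeled (n + ls.length) ∧ m * a ≤ altCount t' :=
  ⟨_, h.attach hp, (Nat.mul_le_mul hm.ge ha).trans (h.altCount_attach ho hd hl)⟩

theorem Labeled.exists_altCount_two {t : BTree} {n a : ℕ} (h : t.Labeled n) (ho : Odd n)
    (ha : a ≤ t.peakCount) : ∃ t' : BTree, t'.Labeled (n + 2) ∧ 4 * a ≤ altCount t' :=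
  h.exists_altCount ho ha (ls := [2, 1]) (by decide +kernel) (by decide) (by decide +kernel)
    (by decide)

theorem Labeled.exists_altCount_three {t : BTree} {n a : ℕ} (h : t.Labeled n) (ho : Odd n)
    (ha : a ≤ t.peakCount) : ∃ t' : BTree, t'.Labeled (n + 3) ∧ 6 * a ≤ altCount t' :=
  h.exists_altCount ho ha (ls := [2, 3, 1]) (by decide +kernel) (by decide) (by decide +kernel)
    (by decide)

theorem exists_peakCount_one (k : ℕ) :
    ∃ t : BTree, t.Labeled (1 + 4 * k) ∧ 6 ^ k ≤ t.peakCount := by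
  obtain ⟨t, ht, h⟩ := exists_labeled_add_mul_four labeled_leaf odd_one k
  rw [peakCount_leaf, one_mul] at h
  exact ⟨t, ht, h⟩

theorem exists_peakCount_seven (k : ℕ) :
    ∃ t : BTree, t.Labeled (7 + 4 * k) ∧ 14 * 6 ^ k ≤ t.peakCount := by
  have h7 : (node (leaf 7) tree₆).Labeled 7 := by unfold Labeled; decide
  obtain ⟨t, ht, h⟩ := exists_labeled_add_mul_four h7 (by decide) k
  exact ⟨t, ht, (Nat.mul_le_mul_right _ le_peakCount_node_tree₆).trans h⟩

theorem odd_add_four_mul {n : ℕ} (h : Odd n) (k : ℕ) : Odd (n + 4 * k) :=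
  h.add_even ⟨2 * k, by ring⟩

theorem rAlt_two : rAlt 2 = 2 := by
  obtain ⟨t, ht, h⟩ := labeled_leaf.exists_altCount odd_one (peakCount_leaf 1).ge (ls := [1])
    (m := 2) (by decide +kernel) (by decide) (by decide +kernel) (by decide)
  exact rAlt_eq ht h 2 (by decide) (by decide)

theorem rAlt_three : rAlt 3 = 4 := by
  obtain ⟨t, ht, h⟩ := labeled_leaf.exists_altCount_two odd_one (peakCount_leaf 1).ge
  exact rAlt_eq ht h 4 (by decide) (by decide)

theorem rAlt_four : rAlt 4 = 6 := by
  obtain ⟨t, ht, h⟩ := labeled_leaf.exists_altCount_three odd_one (peakCount_leaf 1).ge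
  exact rAlt_eq ht h 6 (by decide) (by decide)

theorem rAlt_five : rAlt 5 = 8 := by
  obtain ⟨t, ht, h⟩ := labeled_leaf.exists_altCount odd_one (peakCount_leaf 1).ge
    (ls := [4, 2, 3, 1]) (m := 8) (by decide +kernel) (by decide) (by decide +kernel)
    (by decide)
  exact rAlt_eq ht h 8 (by decide) (by decide)

theorem red_eq {n i k : ℕ} (hi : i < 4) (h : n = 14 + i + 4 * k) : red n = 14 + i := by
  unfold red
  split_ifs <;> omega

theorem periods_eq {n i k : ℕ} (hi : i < 4) (h : n = 14 + i + 4 * k) : periods n = k := by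
  unfold periods
  split_ifs <;> omega

theorem rAlt_six_add (k : ℕ) : rAlt (6 + 4 * k) = 14 * 6 ^ k := by
  rcases k with _ | k
  · exact rAlt_eq (t := tree₆) (by unfold Labeled; decide) le_altCount_tree₆ 14 (by decide)
      (by decide)
  · obtain ⟨t, ht, h⟩ := exists_peakCount_seven k
    obtain ⟨t, ht, h⟩ := ht.exists_altCount_three (odd_add_four_mul (by decide) k) h
    rw [show 7 + 4 * k + 3 = 6 + 4 * (k + 1) by ring] at ht
    rw [show 6 * (14 * 6 ^ k) = 14 * 6 ^ (k + 1) by ring] at h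
    rcases k with _ | k
    · exact rAlt_eq ht h 84 (by decide) (by decide)
    · have e : 6 + 4 * (k + 1 + 1) = 14 + 0 + 4 * k := by ring
      refine rAlt_eq ht h 504 ?_ ?_
      · rw [red_eq (by decide) e]; decide
      · rw [periods_eq (by decide) e]; exact le_of_eq (by ring)

theorem rAlt_seven_add (k : ℕ) : rAlt (7 + 4 * k) = 24 * 6 ^ k := by
  obtain ⟨t, ht, h⟩ := exists_peakCount_one (k + 1)
  obtain ⟨t, ht, h⟩ := ht.exists_altCount_two (odd_add_four_mul (by decide) _) h
  rw [show 1 + 4 * (k + 1) + 2 = 7 + 4 * k by ring] at ht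
  rw [show 4 * 6 ^ (k + 1) = 24 * 6 ^ k by ring] at h
  rcases k with _ | _ | k
  · exact rAlt_eq ht h 24 (by decide) (by decide)
  · exact rAlt_eq ht h 144 (by decide) (by decide)
  · have e : 7 + 4 * (k + 1 + 1) = 14 + 1 + 4 * k := by ring
    refine rAlt_eq ht h 864 ?_ ?_
    · rw [red_eq (by decide) e]; decide
    · rw [periods_eq (by decide) e]; exact le_of_eq (by ring)

theorem rAlt_eight_add (k : ℕ) : rAlt (8 + 4 * k) = 36 * 6 ^ k := by
  obtain ⟨t, ht, h⟩ := exists_peakCount_one (k + 1)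
  obtain ⟨t, ht, h⟩ := ht.exists_altCount_three (odd_add_four_mul (by decide) _) h
  rw [show 1 + 4 * (k + 1) + 3 = 8 + 4 * k by ring] at ht
  rw [show 6 * 6 ^ (k + 1) = 36 * 6 ^ k by ring] at h
  rcases k with _ | _ | k
  · exact rAlt_eq ht h 36 (by decide) (by decide)
  · exact rAlt_eq ht h 216 (by decide) (by decide)
  · have e : 8 + 4 * (k + 1 + 1) = 14 + 2 + 4 * k := by ring
    refine rAlt_eq ht h 1296 ?_ ?_
    · rw [red_eq (by decide) e]; decide
    · rw [periods_eq (by decide) e]; exact le_of_eq (by ring)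

theorem rAlt_nine_add (k : ℕ) : rAlt (9 + 4 * k) = 56 * 6 ^ k := by
  obtain ⟨t, ht, h⟩ := exists_peakCount_seven k
  obtain ⟨t, ht, h⟩ := ht.exists_altCount_two (odd_add_four_mul (by decide) _) h
  rw [show 7 + 4 * k + 2 = 9 + 4 * k by ring] at ht
  rw [show 4 * (14 * 6 ^ k) = 56 * 6 ^ k by ring] at h
  rcases k with _ | _ | k
  · exact rAlt_eq ht h 56 (by decide) (by decide)
  · exact rAlt_eq ht h 336 (by decide) (by decide)
  · have e : 9 + 4 * (k + 1 + 1) = 14 + 3 + 4 * k := by ring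
    refine rAlt_eq ht h 2016 ?_ ?_
    · rw [red_eq (by decide) e]; decide
    · rw [periods_eq (by decide) e]; exact le_of_eq (by ring)

end BTree

/-- Theorem 1 (values of `r_n`). -/
theorem rAlt_values :
    rAlt 1 = 1 ∧ rAlt 2 = 2 ∧ rAlt 3 = 4 ∧ rAlt 4 = 6 ∧ rAlt 5 = 8 ∧
    ∀ k : ℕ,
      rAlt (6 + 4 * k) = 14 * 6 ^ k ∧
      rAlt (7 + 4 * k) = 24 * 6 ^ k ∧
      rAlt (8 + 4 * k) = 36 * 6 ^ k ∧
      rAlt (9 + 4 * k) = 56 * 6 ^ k := by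
  refine ⟨BTree.rAlt_one, BTree.rAlt_two, BTree.rAlt_three, BTree.rAlt_four, BTree.rAlt_five,
    fun k => ⟨BTree.rAlt_six_add k, BTree.rAlt_seven_add k, BTree.rAlt_eight_add k,
      BTree.rAlt_nine_add k⟩⟩
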